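/- arXiv:2509.04227 — 3 statements merged into one kernel-verified Lean document; each statement's English description precedes it below -/
import Mathlib

section
/- Let (a,b) ∈ W and let q₀,q₁ > 1. If π_{q,q}(a) < π_{q,q}(b) for every q > 1, then the topological entropy h(Ω_{a,b}) = 0 and dim_H π_{q₀,q₁}(Ω_{a,b}) = 0. -/
open Filter Topology

/-- The base corresponding to a digit: `q0` for digit `0` (`false`), `q1` for digit `1` (`true`). -/
noncomputable def qb (q0 q1 : ℝ) (d : Bool) : ℝ := if d then q1 else q0

/-- `piE q0 q1 i = Σ_{k=1}^∞ i_k / (q_{i_1} ⋯ q_{i_k})`, with 0-based indexing. -/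
noncomputable def piE (q0 q1 : ℝ) (i : ℕ → Bool) : ℝ :=
  ∑' k : ℕ, (if i k then (1 : ℝ) else 0) / ∏ j ∈ Finset.range (k + 1), qb q0 q1 (i j)

/-- Strict lexicographic order `≺` on binary sequences. -/
def lexLt (u v : ℕ → Bool) : Prop := ∃ n : ℕ, (∀ m, m < n → u m = v m) ∧ u n < v n

/-- Non-strict lexicographic order `⪯`. -/
def lexLe (u v : ℕ → Bool) : Prop := lexLt u v ∨ u = v

/-- The tail `i_{n+1} i_{n+2} ⋯` of a sequence (0-based: drop the first `n` entries). -/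
def shiftTail (i : ℕ → Bool) (n : ℕ) : ℕ → Bool := fun k => i (n + k)

/-- `Omega a b` : sequences none of whose tails lies in the open lexicographic interval `]a,b[`. -/
def Omega (a b : ℕ → Bool) : Set (ℕ → Bool) :=
  {i | ∀ n : ℕ, ¬ (lexLt a (shiftTail i n) ∧ lexLt (shiftTail i n) b)}

/-- `(a,b) ∈ W` : `a` starts with digit 0, `b` starts with digit 1, and `a, b ∈ Ω_{a,b}`. -/
def memW (a b : ℕ → Bool) : Prop :=
  a 0 = false ∧ b 0 = true ∧ a ∈ Omega a b ∧ b ∈ Omega a b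

/-- The set `L_{a,b,n}` of length-`n` prefixes of elements of `Ω_{a,b}`, as a finset. -/
noncomputable def Lwords (a b : ℕ → Bool) (n : ℕ) : Finset (Fin n → Bool) :=
  Set.Finite.toFinset
    (Set.toFinite {w : Fin n → Bool | ∃ i ∈ Omega a b, ∀ k : Fin n, i k.1 = w k})

/-- Topological entropy `h(Ω_{a,b}) = lim_{n→∞} (1/n) log #L_{a,b,n}`; the limit exists by
subadditivity, hence it coincides with the `limsup` used here. -/
noncomputable def entropy (a b : ℕ → Bool) : ℝ :=
  Filter.limsup (fun n : ℕ => Real.log ((Lwords a b n).card) / n) Filter.atTop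


namespace Aux

def cs (d : Bool) (i : ℕ → Bool) : ℕ → Bool := fun n => Nat.casesOn n d (fun k => i k)

@[simp] lemma cs_zero (d i) : cs d i 0 = d := rfl
@[simp] lemma cs_succ (d i n) : cs d i (n+1) = i n := rfl

lemma cs_eta (u : ℕ → Bool) : cs (u 0) (shiftTail u 1) = u := by
  funext n; cases n with
  | zero => rfl
  | succ k => simp [shiftTail, add_comm]

lemma shift_cs (d i n) : shiftTail (cs d i) (n+1) = shiftTail i n := by
  funext k; simp only [shiftTail]; rw [show n + 1 + k = (n + k) + 1 by ring]; rfl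

lemma shift_zero (i) : shiftTail i 0 = i := by funext k; simp [shiftTail]

lemma shift_shift (i m n) : shiftTail (shiftTail i m) n = shiftTail i (m+n) := by
  funext k; simp [shiftTail, add_assoc]

lemma lt_iff (u v : ℕ → Bool) : lexLt u v ↔ toLex u < toLex v := Iff.rfl

lemma nlt_trans {i v u : ℕ → Bool} (h1 : ¬ lexLt v i) (h2 : ¬ lexLt u v) : ¬ lexLt u i := by
  have h1' : toLex i ≤ toLex v := le_of_not_gt h1
  have h2' : toLex v ≤ toLex u := le_of_not_gt h2
  exact not_lt_of_ge (h1'.trans h2')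

lemma nlt_of_lt {i v : ℕ → Bool} (h1 : lexLt i v) : ¬ lexLt v i := by
  have h1' : toLex i < toLex v := h1
  exact not_lt_of_gt h1'

lemma cs_lt (d i j) : lexLt (cs d i) (cs d j) ↔ lexLt i j := by
  constructor
  · rintro ⟨n, h1, h2⟩
    cases n with
    | zero => simp at h2
    | succ n => exact ⟨n, fun m hm => h1 (m+1) (by omega), h2⟩
  · rintro ⟨n, h1, h2⟩
    refine ⟨n+1, fun m hm => ?_, h2⟩
    cases m with
    | zero => rfl
    | succ m => exact h1 m (by omega)

lemma cs_lt' (i j) : lexLt (cs false i) (cs true j) := ⟨0, by simp, by simp⟩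

lemma cs_nlt (i j) : ¬ lexLt (cs true i) (cs false j) := by
  have := cs_lt' j i
  rw [lt_iff] at *
  exact not_lt_of_gt this

/-- The first n letters of a sequence. -/
def pre (n : ℕ) (i : ℕ → Bool) : Fin n → Bool := fun k => i k

lemma pre_eq (n i j) : pre n i = pre n j ↔ ∀ k < n, i k = j k := by
  constructor
  · intro h k hk; exact congrFun h ⟨k, hk⟩
  · intro h; funext k; exact h k k.2

noncomputable def N (n : ℕ) (S : Set (ℕ → Bool)) : ℕ := (pre n '' S).ncard

lemma pre_cs (n d i) : pre (n+1) (cs d i) = Fin.cons d (pre n i) := by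
  funext k
  refine Fin.cases ?_ (fun k => ?_) k <;> simp [pre]

lemma N_cs (n d S) : N (n+1) (cs d '' S) = N n S := by
  unfold N
  have : pre (n+1) '' (cs d '' S) = (Fin.cons (α := fun _ => Bool) d) '' (pre n '' S) := by
    simp only [Set.image_image, pre_cs]
  rw [this]
  exact Set.ncard_image_of_injective _ (Fin.cons_right_injective (α := fun _ => Bool) d)

lemma N_union (n S T) : N (n+1) (cs false '' S ∪ cs true '' T) = N n S + N n T := by
  rw [← N_cs n false S, ← N_cs n true T]
  unfold N
  rw [Set.image_union, Set.ncard_union_eq]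
  rw [Set.disjoint_left]
  rintro _ ⟨_, ⟨i, _, rfl⟩, rfl⟩ ⟨_, ⟨j, _, rfl⟩, h⟩
  have := (pre_eq _ _ _).1 h 0 (by omega)
  simp at this

lemma sandwich (n : ℕ) (i v j : ℕ → Bool) (h1 : ¬ lexLt v i) (h2 : ¬ lexLt j v)
    (h : pre n i = pre n j) : pre n v = pre n i := by
  rw [pre_eq] at *
  intro k
  induction k using Nat.strong_induction_on with
  | _ k ih =>
    intro hk
    by_contra hne
    have e := h k hk
    rcases lt_or_gt_of_ne hne with h' | h'
    · exact h1 ⟨k, fun m hm => ih m hm (by omega), h'⟩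
    · refine h2 ⟨k, fun m hm => ?_, ?_⟩
      · rw [ih m hm (by omega), h m (by omega)]
      · rw [← e]; exact h'

def lo (a b u : ℕ → Bool) : Set (ℕ → Bool) := {i | i ∈ Omega a b ∧ ¬ lexLt u i}
def mid (a b v u : ℕ → Bool) : Set (ℕ → Bool) := {i | i ∈ Omega a b ∧ ¬ lexLt u i ∧ ¬ lexLt i v}

lemma N_mid (n : ℕ) (a b v u : ℕ → Bool) (hv : v ∈ Omega a b) (hvu : ¬ lexLt u v) :
    N n (mid a b v u) + N n (lo a b v) = N n (lo a b u) + 1 := by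
  unfold N
  rw [← Set.ncard_union_add_ncard_inter, ← Set.image_union]
  congr 1
  · congr 2
    ext i
    simp only [mid, lo, Set.mem_union, Set.mem_ofPred_eq]
    constructor
    · rintro (⟨h1, h2, h3⟩ | ⟨h1, h2⟩)
      · exact ⟨h1, h2⟩
      · exact ⟨h1, nlt_trans h2 hvu⟩
    · rintro ⟨h1, h2⟩
      by_cases h : lexLt i v
      · exact Or.inr ⟨h1, nlt_of_lt h⟩
      · exact Or.inl ⟨h1, h2, h⟩
  · rw [Set.ncard_eq_one]
    refine ⟨pre n v, ?_⟩
    ext w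
    simp only [Set.mem_inter_iff, Set.mem_image, Set.mem_singleton_iff]
    constructor
    · rintro ⟨⟨j, ⟨_, _, h3⟩, rfl⟩, ⟨i, ⟨_, h4⟩, e⟩⟩
      rw [← e]; exact (sandwich n i v j h4 h3 e).symm
    · rintro rfl
      have : ¬ lexLt v v := by rw [lt_iff]; exact lt_irrefl _
      exact ⟨⟨v, ⟨hv, hvu, this⟩, rfl⟩, ⟨v, ⟨hv, this⟩, rfl⟩⟩

section main
variable {a b : ℕ → Bool}

lemma shift_mem {i} (hi : i ∈ Omega a b) (n) : shiftTail i n ∈ Omega a b := by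
  intro m; rw [shift_shift]; exact hi _

lemma mem_cs (d i) : cs d i ∈ Omega a b ↔ i ∈ Omega a b ∧ ¬ (lexLt a (cs d i) ∧ lexLt (cs d i) b) := by
  constructor
  · intro h
    exact ⟨fun n => by have := h (n+1); rwa [shift_cs] at this, by have := h 0; rwa [shift_zero] at this⟩
  · rintro ⟨h1, h2⟩ n
    cases n with
    | zero => rwa [shift_zero]
    | succ n => rw [shift_cs]; exact h1 n

lemma mem_cs0 (hW : memW a b) (i) : cs false i ∈ Omega a b ↔ i ∈ Omega a b ∧ ¬ lexLt (shiftTail a 1) i := by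
  rw [mem_cs]
  have ha := cs_eta a; have hb := cs_eta b
  rw [hW.1] at ha; rw [hW.2.1] at hb
  have h1 : lexLt a (cs false i) ↔ lexLt (shiftTail a 1) i := by
    rw [← cs_lt false (shiftTail a 1), ha]
  have h2 : lexLt (cs false i) b := by rw [← hb]; exact cs_lt' _ _
  rw [h1]; tauto

lemma mem_cs1 (hW : memW a b) (i) : cs true i ∈ Omega a b ↔ i ∈ Omega a b ∧ ¬ lexLt i (shiftTail b 1) := by
  rw [mem_cs]
  have ha := cs_eta a; have hb := cs_eta b
  rw [hW.1] at ha; rw [hW.2.1] at hb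
  have h1 : lexLt (cs true i) b ↔ lexLt i (shiftTail b 1) := by
    rw [← cs_lt true _ (shiftTail b 1), hb]
  have h2 : lexLt a (cs true i) := by rw [← ha]; exact cs_lt' _ _
  rw [h1]; tauto

lemma lo0 (hW : memW a b) (u) (hu : cs false u ∈ Omega a b) :
    lo a b (cs false u) = cs false '' (lo a b u) := by
  rw [mem_cs0 hW] at hu
  ext i
  simp only [lo, Set.mem_ofPred_eq, Set.mem_image]
  constructor
  · rintro ⟨h1, h2⟩
    have e := cs_eta i
    cases hi : i 0
    · rw [hi] at e
      refine ⟨_, ⟨shift_mem h1 1, ?_⟩, e⟩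
      rwa [← e, cs_lt] at h2
    · rw [hi] at e
      rw [← e] at h2
      exact absurd (cs_lt' _ _) h2
  · rintro ⟨i, ⟨h1, h2⟩, rfl⟩
    rw [cs_lt, mem_cs0 hW]
    refine ⟨⟨h1, ?_⟩, h2⟩
    exact nlt_trans h2 hu.2

lemma lo1 (hW : memW a b) (u) :
    lo a b (cs true u) = cs false '' (lo a b (shiftTail a 1)) ∪ cs true '' (mid a b (shiftTail b 1) u) := by
  ext i
  simp only [lo, mid, Set.mem_ofPred_eq, Set.mem_image, Set.mem_union]
  constructor
  · rintro ⟨h1, h2⟩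
    have e := cs_eta i
    cases hi : i 0
    · rw [hi] at e
      left
      rw [← e, mem_cs0 hW] at h1
      exact ⟨_, h1, e⟩
    · rw [hi] at e
      right
      rw [← e, mem_cs1 hW] at h1
      rw [← e, cs_lt] at h2
      exact ⟨_, ⟨h1.1, h2, h1.2⟩, e⟩
  · rintro (⟨i, h1, rfl⟩ | ⟨i, ⟨h1, h2, h3⟩, rfl⟩)
    · exact ⟨(mem_cs0 hW i).2 h1, cs_nlt _ _⟩
    · rw [cs_lt, mem_cs1 hW]; exact ⟨⟨h1, h3⟩, h2⟩

noncomputable def F (a b : ℕ → Bool) (n : ℕ) (u : ℕ → Bool) : ℝ := N n (lo a b u)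
noncomputable def c (a b : ℕ → Bool) (n : ℕ) : ℝ := F a b n (shiftTail a 1) - F a b n (shiftTail b 1) + 1

lemma F_zero (u) (hu : u ∈ Omega a b) : F a b 0 u = 1 := by
  unfold F N
  have : pre 0 '' lo a b u = {pre 0 u} := by
    ext w
    simp only [Set.mem_image, Set.mem_singleton_iff]
    refine ⟨fun _ => Subsingleton.elim _ _, fun _ => ⟨u, ⟨hu, ?_⟩, Subsingleton.elim _ _⟩⟩
    rw [lt_iff]; exact lt_irrefl _
  rw [this]; simp

lemma F_succ (hW : memW a b) (n u) (hu : u ∈ Omega a b) :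
    F a b (n+1) u = (if u 0 then 1 else 0) * c a b n + F a b n (shiftTail u 1) := by
  have e := cs_eta u
  cases h : u 0
  · rw [h] at e
    conv_lhs => rw [← e]
    unfold F
    rw [lo0 hW _ (by rwa [e]), N_cs]; simp
  · rw [h] at e
    conv_lhs => rw [← e]
    unfold c F
    rw [lo1 hW, N_union]
    rw [← e, mem_cs1 hW] at hu
    have := N_mid n a b (shiftTail b 1) (shiftTail u 1) (shift_mem hW.2.2.2 1) hu.2
    have h2 : (N n (mid a b (shiftTail b 1) (shiftTail u 1)) : ℝ) + N n (lo a b (shiftTail b 1)) = N n (lo a b (shiftTail u 1)) + 1 := by exact_mod_cast this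
    push_cast; simp; linarith

lemma F_sum (hW : memW a b) (n) : ∀ u, u ∈ Omega a b →
    F a b n u = 1 + ∑ k ∈ Finset.range n, (if u k then 1 else 0) * c a b (n - 1 - k) := by
  induction n with
  | zero => intro u hu; simp [F_zero u hu]
  | succ n ih =>
    intro u hu
    rw [F_succ hW n u hu, ih _ (shift_mem hu 1), Finset.sum_range_succ']
    have : ∀ k, shiftTail u 1 k = u (k+1) := fun k => by simp [shiftTail, add_comm]
    simp only [this]
    have e : ∀ k, n - 1 - k = n + 1 - 1 - (k+1) := by intro k; omega
    simp only [e]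
    simp; ring

lemma conv_one (hW : memW a b) (n) :
    ∑ k ∈ Finset.range (n+1), ((if b k then 1 else 0) - (if a k then 1 else 0)) * c a b (n - k) = 1 := by
  have h1 := F_sum hW (n+1) a hW.2.2.1
  have h2 := F_sum hW (n+1) b hW.2.2.2
  have h3 := F_succ hW n a hW.2.2.1
  have h4 := F_succ hW n b hW.2.2.2
  simp only [hW.1, hW.2.1, c] at h3 h4
  simp only [sub_mul, Finset.sum_sub_distrib]
  simp only [Nat.add_sub_cancel] at h1 h2
  simp at h3 h4
  linarith

noncomputable def Ln (a b : ℕ → Bool) (n : ℕ) : ℝ := N n (Omega a b)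

lemma one_mem (hW : memW a b) : (fun _ => true) ∈ Omega a b := by
  intro n
  rintro ⟨_, k, h1, h2⟩
  exact absurd h2 (by simp [shiftTail, Bool.lt_iff])

lemma Ln_eq_F (hW : memW a b) (n) : Ln a b n = F a b n (fun _ => true) := by
  have : lo a b (fun _ => true) = Omega a b := by
    ext i
    simp only [lo, Set.mem_ofPred_eq, and_iff_left_iff_imp]
    rintro _ ⟨k, h1, h2⟩
    exact absurd h2 (by simp [Bool.lt_iff])
  unfold Ln F; rw [this]

lemma Ln_zero (hW : memW a b) : Ln a b 0 = 1 := by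
  rw [Ln_eq_F hW, F_zero _ (one_mem hW)]

lemma Ln_succ (hW : memW a b) (n) : Ln a b (n+1) = c a b n + Ln a b n := by
  rw [Ln_eq_F hW, F_succ hW n _ (one_mem hW), Ln_eq_F hW]; simp; rfl

lemma N_le_succ (n S) : N n S ≤ N (n+1) S := by
  unfold N
  have : pre n '' S = (fun w : Fin (n+1) → Bool => fun k : Fin n => w k.castSucc) '' (pre (n+1) '' S) := by
    rw [Set.image_image]; rfl
  rw [this]
  exact Set.ncard_image_le (Set.toFinite _)

lemma c_nonneg (hW : memW a b) (n) : 0 ≤ c a b n := by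
  have := Ln_succ hW n
  have h : Ln a b n ≤ Ln a b (n+1) := by unfold Ln; exact_mod_cast N_le_succ _ _
  linarith

lemma Ln_pos (hW : memW a b) (n) : 1 ≤ Ln a b n := by
  induction n with
  | zero => rw [Ln_zero hW]
  | succ n ih => have := Ln_succ hW n; have := c_nonneg hW n; linarith

lemma Ln_mul (m n) : Ln a b (m+n) ≤ Ln a b m * Ln a b n := by
  unfold Ln
  have : N (m+n) (Omega a b) ≤ N m (Omega a b) * N n (Omega a b) := by
    unfold N
    rw [← Set.ncard_prod]
    refine Set.ncard_le_ncard_of_injOn (fun w => (fun k => w (Fin.castAdd n k), fun k => w (Fin.natAdd m k))) ?_ ?_ (Set.toFinite _)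
    · rintro _ ⟨i, hi, rfl⟩
      exact ⟨⟨i, hi, rfl⟩, ⟨shiftTail i m, shift_mem hi m, rfl⟩⟩
    · intro w _ w' _ h
      simp only [Prod.mk.injEq] at h
      funext k
      refine Fin.addCases (fun k => congrFun h.1 k) (fun k => congrFun h.2 k) k
  exact_mod_cast this

lemma Lwords_card (n) : ((Lwords a b n).card : ℝ) = Ln a b n := by
  unfold Ln N Lwords
  rw [← Set.ncard_eq_toFinset_card]
  congr 3
  ext w
  constructor
  · rintro ⟨i, hi, h⟩; exact ⟨i, hi, funext h⟩
  · rintro ⟨i, hi, rfl⟩; exact ⟨i, hi, fun _ => rfl⟩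

lemma subadd (hW : memW a b) : Subadditive (fun n => Real.log (Ln a b n)) := by
  intro m n
  have h1 := Ln_pos hW m; have h2 := Ln_pos hW n; have h3 := Ln_pos hW (m+n)
  rw [← Real.log_mul (by linarith) (by linarith)]
  exact Real.log_le_log (by linarith) (Ln_mul m n)

lemma bdd (hW : memW a b) : BddBelow (Set.range fun n : ℕ => Real.log (Ln a b n) / n) := by
  refine ⟨0, ?_⟩
  rintro _ ⟨n, rfl⟩
  exact div_nonneg (Real.log_nonneg (Ln_pos hW n)) (by positivity)

lemma tend (hW : memW a b) : Tendsto (fun n : ℕ => Real.log (Ln a b n) / n) atTop (𝓝 (entropy a b)) := by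
  have h := (subadd hW).tendsto_lim (bdd hW)
  have : entropy a b = (subadd hW).lim := by
    unfold entropy; simp only [Lwords_card]; exact h.limsup_eq
  rwa [this]

lemma ent_le (hW : memW a b) (n : ℕ) (hn : n ≠ 0) : entropy a b * n ≤ Real.log (Ln a b n) := by
  have h := (subadd hW).tendsto_lim (bdd hW)
  have e : entropy a b = (subadd hW).lim := by
    unfold entropy; simp only [Lwords_card]; exact h.limsup_eq
  have := (subadd hW).lim_le_div (bdd hW) hn
  rw [← e] at this
  rwa [le_div_iff₀ (by positivity)] at this

lemma ent_nonneg (hW : memW a b) : 0 ≤ entropy a b :=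
  ge_of_tendsto' (tend hW) fun n => div_nonneg (Real.log_nonneg (Ln_pos hW n)) (by positivity)

/-- exponential upper bound -/
lemma Ln_le (hW : memW a b) (t : ℝ) (ht : entropy a b < t) : ∀ᶠ n : ℕ in atTop, Ln a b n ≤ Real.exp (t * n) := by
  filter_upwards [(tend hW).eventually (gt_mem_nhds ht), eventually_gt_atTop 0] with n h1 h2
  have h3 : (0:ℝ) < n := by exact_mod_cast h2
  rw [div_lt_iff₀ h3] at h1
  rw [← Real.log_le_iff_le_exp (by linarith [Ln_pos hW n])]
  exact h1.le

noncomputable def dd (a b : ℕ → Bool) (k : ℕ) : ℝ := (if b k then 1 else 0) - (if a k then 1 else 0)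

noncomputable def D (a b : ℕ → Bool) (x : ℝ) : ℝ := ∑' k, dd a b k * x ^ k

lemma dd_abs (k) : |dd a b k| ≤ 1 := by
  unfold dd; split_ifs <;> simp

lemma piE_eq (q : ℝ) (u : ℕ → Bool) :
    piE q q u = ∑' k : ℕ, (if u k then (1:ℝ) else 0) * (q⁻¹) ^ (k+1) := by
  unfold piE
  refine tsum_congr fun k => ?_
  have : ∀ d, qb q q d = q := by intro d; unfold qb; simp
  simp [this, div_eq_mul_inv]

lemma sumb (x : ℝ) (hx : 0 ≤ x) (hx1 : x < 1) (u : ℕ → Bool) :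
    Summable fun k : ℕ => (if u k then (1:ℝ) else 0) * x ^ (k+1) := by
  have h : Summable fun k : ℕ => x ^ (k+1) := (summable_nat_add_iff 1).2 (summable_geometric_of_lt_one hx hx1)
  refine Summable.of_nonneg_of_le (fun k => ?_) (fun k => ?_) h
  · split_ifs <;> positivity
  · split_ifs
    · simp
    · simp; positivity

lemma D_pos (hW : memW a b) (h : ∀ q : ℝ, 1 < q → piE q q a < piE q q b) (x : ℝ) (hx : 0 ≤ x)
    (hx1 : x < 1) : 0 < D a b x := by
  rcases hx.eq_or_lt with rfl | hx
  · unfold D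
    rw [tsum_eq_single 0]
    · simp [dd, hW.1, hW.2.1]
    · intro k hk; simp [hk]
  · have := h x⁻¹ ((one_lt_inv₀ hx).2 hx1)
    rw [piE_eq, piE_eq, inv_inv, ← sub_pos, ← (sumb x hx.le hx1 b).tsum_sub (sumb x hx.le hx1 a)] at this
    have e : ∀ k, (if b k then (1:ℝ) else 0) * x ^ (k+1) - (if a k then (1:ℝ) else 0) * x ^ (k+1)
        = x * (dd a b k * x^k) := by intro k; unfold dd; ring
    simp only [e, tsum_mul_left] at this
    exact pos_of_mul_pos_right this hx.le

lemma D_cont (R : ℝ) (hR1 : R < 1) : ContinuousOn (D a b) (Set.Icc 0 R) := by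
  rcases lt_or_ge R 0 with h | hR
  · rw [Set.Icc_eq_empty (by linarith)]; exact continuousOn_empty _
  unfold D
  refine continuousOn_tsum (u := fun k => R^k) (fun k => by fun_prop) (summable_geometric_of_lt_one hR hR1) ?_
  intro k x hx
  rw [norm_mul, norm_pow, Real.norm_eq_abs, Real.norm_eq_abs, abs_of_nonneg hx.1]
  calc _ ≤ 1 * R^k := mul_le_mul (dd_abs k) (pow_le_pow_left₀ hx.1 hx.2 k) (pow_nonneg hx.1 _) zero_le_one
    _ = _ := one_mul _

lemma c_summable (hW : memW a b) (x : ℝ) (hx : 0 ≤ x) (hxR : x < Real.exp (-entropy a b)) :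
    Summable fun n => c a b n * x ^ n := by
  obtain ⟨y, hxy, hyR⟩ := exists_between hxR
  have hy : 0 < y := by linarith
  have ht : entropy a b < -Real.log y := by
    have := (Real.log_lt_iff_lt_exp hy).2 hyR
    linarith
  have hb := (tendsto_add_atTop_nat 1).eventually (Ln_le hW _ ht)
  have hs : Summable fun n : ℕ => y⁻¹ * (x / y)^n :=
    (summable_geometric_of_lt_one (by positivity) ((div_lt_one hy).2 hxy)).mul_left _
  refine Summable.of_norm_bounded_eventually_nat hs ?_
  filter_upwards [hb] with n hn
  have h1 := Ln_succ hW n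
  have h2 := Ln_pos hW n
  have h3 : Real.exp (-Real.log y * ((n+1 : ℕ):ℝ)) = y⁻¹ ^ (n+1) := by
    rw [mul_comm, Real.exp_nat_mul, Real.exp_neg, Real.exp_log hy]
  rw [h3] at hn
  rw [Real.norm_of_nonneg (mul_nonneg (c_nonneg hW n) (by positivity))]
  calc c a b n * x^n ≤ y⁻¹^(n+1) * x^n := by gcongr; linarith
    _ = _ := by rw [div_pow, inv_pow, pow_succ]; field_simp

lemma DP (hW : memW a b) (x : ℝ) (hx : 0 ≤ x) (hx1 : x < 1) (hxR : x < Real.exp (-entropy a b)) :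
    D a b x * ∑' n, c a b n * x ^ n = (1 - x)⁻¹ := by
  have h1 : Summable fun k => ‖dd a b k * x^k‖ := by
    refine Summable.of_nonneg_of_le (fun k => norm_nonneg _) (fun k => ?_) (summable_geometric_of_lt_one hx hx1)
    rw [norm_mul, norm_pow, Real.norm_eq_abs, Real.norm_eq_abs, abs_of_nonneg hx]
    exact mul_le_of_le_one_left (by positivity) (dd_abs k)
  have h2 : Summable fun n => ‖c a b n * x ^ n‖ := (c_summable hW x hx hxR).norm
  unfold D
  rw [tsum_mul_tsum_eq_tsum_sum_range_of_summable_norm h1 h2, ← tsum_geometric_of_lt_one hx hx1]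
  refine tsum_congr fun n => ?_
  have := conv_one hW n
  calc _ = ∑ k ∈ Finset.range (n+1), (((if b k then (1:ℝ) else 0) - (if a k then 1 else 0)) * c a b (n - k)) * x^n := by
        refine Finset.sum_congr rfl fun k hk => ?_
        have hk : k ≤ n := by simpa [Nat.lt_succ_iff] using hk
        rw [show x^n = x^k * x^(n-k) by rw [← pow_add]; congr 1; omega]
        unfold dd; ring
    _ = _ := by rw [← Finset.sum_mul, this, one_mul]

lemma ent_zero (hW : memW a b) (h : ∀ q : ℝ, 1 < q → piE q q a < piE q q b) : entropy a b = 0 := by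
  by_contra hne
  have hpos : 0 < entropy a b := lt_of_le_of_ne (ent_nonneg hW) (Ne.symm hne)
  set R := Real.exp (-entropy a b) with hRdef
  have hR0 : 0 < R := Real.exp_pos _
  have hR1 : R < 1 := by rw [hRdef, Real.exp_lt_one_iff]; linarith
  obtain ⟨z, hz, hmin⟩ := isCompact_Icc.exists_isMinOn (Set.nonempty_Icc.2 hR0.le) (D_cont (a := a) (b := b) R hR1)
  set δ := D a b z with hδ
  have hδ0 : 0 < δ := D_pos hW h z hz.1 (by linarith [hz.2])
  set C := (1 - R)⁻¹ / δ with hC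
  -- partial sums bounded for x < R
  have hb : ∀ M : ℕ, ∀ x ∈ Set.Ico 0 R, ∑ m ∈ Finset.range M, c a b m * x^m ≤ C := by
    intro M x hx
    have h1 := DP hW x hx.1 (by linarith [hx.2]) hx.2
    have h2 : δ ≤ D a b x := hmin ⟨hx.1, hx.2.le⟩
    have h3 := (c_summable hW x hx.1 hx.2).sum_le_tsum (Finset.range M)
      (fun m _ => mul_nonneg (c_nonneg hW m) (pow_nonneg hx.1 _))
    have h4 : 0 ≤ ∑ m ∈ Finset.range M, c a b m * x^m :=
      Finset.sum_nonneg (fun m _ => mul_nonneg (c_nonneg hW m) (pow_nonneg hx.1 _))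
    rw [hC, le_div_iff₀ hδ0]
    calc _ ≤ (∑' n, c a b n * x ^ n) * D a b x := by
          apply mul_le_mul h3 h2 hδ0.le (h4.trans h3)
      _ = (1 - x)⁻¹ := by rw [mul_comm, h1]
      _ ≤ _ := by
        apply inv_anti₀ (by linarith) ; linarith [hx.2]
  have hbR : ∀ M : ℕ, ∑ m ∈ Finset.range M, c a b m * R^m ≤ C := by
    intro M
    have hc : Continuous fun x : ℝ => ∑ m ∈ Finset.range M, c a b m * x^m := by fun_prop
    have : Set.Icc 0 R ⊆ {x | ∑ m ∈ Finset.range M, c a b m * x^m ≤ C} := by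
      rw [← closure_Ico hR0.ne]
      exact closure_minimal (fun x hx => hb M x hx) (isClosed_le hc continuous_const)
    exact this ⟨hR0.le, le_rfl⟩
  -- sum of Ln n R^n
  have hT : ∀ M : ℕ, (1 - R) * ∑ n ∈ Finset.range M, Ln a b n * R^n ≤ 1 + R * ∑ m ∈ Finset.range M, c a b m * R^m - Ln a b M * R^M := by
    intro M
    induction M with
    | zero => simp [Ln_zero hW]
    | succ M ih =>
      rw [Finset.sum_range_succ, Finset.sum_range_succ, Ln_succ hW M, pow_succ]
      linarith
  have hL : ∀ n, 1 ≤ Ln a b n * R^n := by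
    intro n
    rcases Nat.eq_zero_or_pos n with rfl | hn
    · simp [Ln_zero hW]
    · have h1 := ent_le hW n hn.ne'
      rw [Real.le_log_iff_exp_le (by linarith [Ln_pos hW n])] at h1
      have : R^n = Real.exp (-(entropy a b * n)) := by
        rw [hRdef, ← Real.exp_nat_mul]; congr 1; ring
      rw [this]
      calc (1:ℝ) = Real.exp (entropy a b * n) * Real.exp (-(entropy a b * n)) := by
            rw [← Real.exp_add]; simp
        _ ≤ _ := by gcongr
  have hfin : ∀ M : ℕ, (1 - R) * M ≤ 1 + R * C := by
    intro M
    have h1 : (M:ℝ) ≤ ∑ n ∈ Finset.range M, Ln a b n * R^n := by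
      calc (M:ℝ) = ∑ n ∈ Finset.range M, (1:ℝ) := by simp
        _ ≤ _ := Finset.sum_le_sum fun n _ => hL n
    have h2 := hT M
    have h3 := hL M
    have h4 := mul_le_mul_of_nonneg_left (hbR M) hR0.le
    have h5 := mul_le_mul_of_nonneg_left h1 (by linarith : 0 ≤ 1 - R)
    linarith
  obtain ⟨M, hM⟩ := exists_nat_gt ((1 + R * C) / (1 - R))
  rw [div_lt_iff₀ (by linarith)] at hM
  linarith [hfin M]

/-! Hausdorff dimension -/

lemma term_bound (q0 q1 q : ℝ) (hq : 1 < q) (h0 : q ≤ q0) (h1 : q ≤ q1) (i : ℕ → Bool) (k : ℕ) :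
    0 ≤ (if i k then (1 : ℝ) else 0) / ∏ j ∈ Finset.range (k + 1), qb q0 q1 (i j) ∧
    (if i k then (1 : ℝ) else 0) / ∏ j ∈ Finset.range (k + 1), qb q0 q1 (i j) ≤ q⁻¹ ^ k := by
  have hp : q ^ (k+1) ≤ ∏ j ∈ Finset.range (k + 1), qb q0 q1 (i j) := by
    calc q^(k+1) = ∏ j ∈ Finset.range (k + 1), q := by simp
      _ ≤ _ := Finset.prod_le_prod (fun _ _ => by linarith) (fun j _ => by unfold qb; split_ifs <;> assumption)
  have hq0 : 0 < q ^ (k+1) := by positivity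
  have hpp := hq0.trans_le hp
  constructor
  · split_ifs <;> positivity
  · calc _ ≤ 1 / ∏ j ∈ Finset.range (k + 1), qb q0 q1 (i j) := by gcongr; split_ifs <;> simp
      _ ≤ 1 / q^(k+1) := by gcongr
      _ ≤ 1 / q^k := by
        gcongr
        · exact hq.le
        · omega
      _ = _ := by simp

noncomputable def tm (q0 q1 : ℝ) (i : ℕ → Bool) (k : ℕ) : ℝ :=
  (if i k then (1 : ℝ) else 0) / ∏ j ∈ Finset.range (k + 1), qb q0 q1 (i j)

lemma pi_dist (q0 q1 q : ℝ) (hq : 1 < q) (h0 : q ≤ q0) (h1 : q ≤ q1) (n : ℕ) (i j : ℕ → Bool)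
    (hij : pre n i = pre n j) : |piE q0 q1 i - piE q0 q1 j| ≤ (1 - q⁻¹)⁻¹ * q⁻¹ ^ n := by
  rw [pre_eq] at hij
  have hx1 : q⁻¹ < 1 := inv_lt_one_of_one_lt₀ hq
  have hx0 : 0 ≤ q⁻¹ := by positivity
  have hg := summable_geometric_of_lt_one hx0 hx1
  have hb : ∀ u k, 0 ≤ tm q0 q1 u k ∧ tm q0 q1 u k ≤ q⁻¹ ^ k :=
    fun u k => term_bound q0 q1 q hq h0 h1 u k
  have hs : ∀ u : ℕ → Bool, Summable (tm q0 q1 u) :=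
    fun u => Summable.of_nonneg_of_le (fun k => (hb u k).1) (fun k => (hb u k).2) hg
  have hp : ∀ u, piE q0 q1 u = ∑' k, tm q0 q1 u k := fun u => rfl
  rw [hp, hp, ← (hs i).sum_add_tsum_nat_add n, ← (hs j).sum_add_tsum_nat_add n]
  have e : ∑ k ∈ Finset.range n, tm q0 q1 i k = ∑ k ∈ Finset.range n, tm q0 q1 j k := by
    refine Finset.sum_congr rfl fun k hk => ?_
    have hk := Finset.mem_range.1 hk
    unfold tm
    rw [hij k hk]
    congr 1
    refine Finset.prod_congr rfl fun l hl => ?_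
    have hl := Finset.mem_range.1 hl
    rw [hij l (by omega)]
  rw [e, add_sub_add_left_eq_sub]
  have tb : ∀ u : ℕ → Bool, 0 ≤ ∑' k, tm q0 q1 u (k+n) ∧
      ∑' k, tm q0 q1 u (k+n) ≤ (1 - q⁻¹)⁻¹ * q⁻¹ ^ n := by
    intro u
    constructor
    · exact tsum_nonneg fun k => (hb u _).1
    · calc _ ≤ ∑' k : ℕ, q⁻¹^(k+n) := by
            exact Summable.tsum_le_tsum (fun k => (hb u _).2)
              ((summable_nat_add_iff n).2 (hs u)) ((summable_nat_add_iff n).2 hg)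
        _ = _ := by simp only [pow_add, tsum_mul_right, tsum_geometric_of_lt_one hx0 hx1]
  have t1 := tb i
  have t2 := tb j
  rw [abs_le]
  constructor <;> linarith [t1.1, t1.2, t2.1, t2.2]

open MeasureTheory Measure in
lemma dim_zero (hW : memW a b) (q0 q1 : ℝ) (hq0 : 1 < q0) (hq1 : 1 < q1) (he : entropy a b = 0) :
    dimH (piE q0 q1 '' Omega a b) = 0 := by
  set q := min q0 q1 with hqd
  have hq : 1 < q := lt_min hq0 hq1
  have hx1 : q⁻¹ < 1 := inv_lt_one_of_one_lt₀ hq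
  have hx0 : 0 < q⁻¹ := by positivity
  set K := (1 - q⁻¹)⁻¹ with hK
  have hK0 : 0 < K := inv_pos.2 (by linarith)
  set r : ℕ → ENNReal := fun n => ENNReal.ofReal (K * q⁻¹ ^ n) with hr
  have hrt : Tendsto r atTop (𝓝 0) := by
    have : Tendsto (fun n : ℕ => K * q⁻¹ ^ n) atTop (𝓝 (K * 0)) :=
      (tendsto_pow_atTop_nhds_zero_of_lt_one hx0.le hx1).const_mul K
    rw [mul_zero] at this
    have h2 := ENNReal.tendsto_ofReal this
    rwa [ENNReal.ofReal_zero] at h2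
  let β : ℕ → Type := fun n => (pre n '' Omega a b : Set (Fin n → Bool))
  have : ∀ n, Fintype (β n) := fun n => Fintype.ofFinite _
  let t : (n : ℕ) → β n → Set ℝ := fun n w => piE q0 q1 '' {i | i ∈ Omega a b ∧ pre n i = w.1}
  have hdiam : ∀ n w, Metric.ediam (t n w) ≤ r n := by
    intro n w
    refine Metric.ediam_le ?_
    rintro _ ⟨i, ⟨_, hi⟩, rfl⟩ _ ⟨j, ⟨_, hj⟩, rfl⟩
    rw [edist_dist, Real.dist_eq]
    exact ENNReal.ofReal_le_ofReal (pi_dist q0 q1 q hq (min_le_left _ _) (min_le_right _ _) n i j (hi.trans hj.symm))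
  have key : ∀ s : ℝ, 0 < s → μH[s] (piE q0 q1 '' Omega a b) = 0 := by
    intro s hs
    have hle := hausdorffMeasure_le_liminf_sum s (piE q0 q1 '' Omega a b) r hrt t
      (Eventually.of_forall hdiam) (Eventually.of_forall fun n => by
        rintro _ ⟨i, hi, rfl⟩
        rw [Set.mem_iUnion]
        exact ⟨⟨pre n i, ⟨i, hi, rfl⟩⟩, ⟨i, ⟨hi, rfl⟩, rfl⟩⟩)
    -- choose exponent
    set τ := s * Real.log q / 2 with hτ
    have hlq : 0 < Real.log q := Real.log_pos hq
    have hτ0 : entropy a b < τ := by rw [he]; positivity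
    have hbd : ∀ᶠ n in atTop, ∑ w, Metric.ediam (t n w) ^ s ≤ ENNReal.ofReal (K ^ s * Real.exp (-τ) ^ n) := by
      filter_upwards [Ln_le hW τ hτ0] with n hn
      have h1 : ∑ w, Metric.ediam (t n w) ^ s ≤ ∑ w : β n, (r n)^s :=
        Finset.sum_le_sum fun w _ => ENNReal.rpow_le_rpow (hdiam n w) hs.le
      refine h1.trans ?_
      have hcard : ((Fintype.card (β n) : ℕ) : ENNReal) = ENNReal.ofReal (Ln a b n) := by
        unfold Ln N
        rw [ENNReal.ofReal_natCast, ← Nat.card_eq_fintype_card]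
        rfl
      rw [Finset.sum_const, nsmul_eq_mul, Finset.card_univ, hcard, hr]
      simp only
      rw [ENNReal.ofReal_rpow_of_nonneg (by positivity) hs.le, ← ENNReal.ofReal_mul (by linarith [Ln_pos hW n])]
      apply ENNReal.ofReal_le_ofReal
      rw [Real.mul_rpow hK0.le (by positivity)]
      have h2 : (q⁻¹ ^ n) ^ s = Real.exp (-(2 * τ * n)) := by
        rw [Real.rpow_def_of_pos (by positivity), Real.log_pow, Real.log_inv, hτ]
        congr 1; ring
      rw [h2]
      calc Ln a b n * (K^s * Real.exp (-(2*τ*n))) ≤ Real.exp (τ * n) * (K^s * Real.exp (-(2*τ*n))) := by gcongr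
        _ = K^s * (Real.exp (τ * n) * Real.exp (-(2*τ*n))) := by ring
        _ = _ := by
          rw [← Real.exp_add, ← Real.exp_nat_mul]; congr 2; ring
    have hlim : Tendsto (fun n : ℕ => ENNReal.ofReal (K ^ s * Real.exp (-τ) ^ n)) atTop (𝓝 0) := by
      have hτp : 0 < τ := by rw [hτ]; positivity
      have : Tendsto (fun n : ℕ => K^s * Real.exp (-τ) ^ n) atTop (𝓝 (K^s * 0)) :=
        (tendsto_pow_atTop_nhds_zero_of_lt_one (Real.exp_pos _).le (by rw [Real.exp_lt_one_iff]; linarith)).const_mul _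
      rw [mul_zero] at this
      simpa using ENNReal.tendsto_ofReal this
    have ht0 : Tendsto (fun n => ∑ w, Metric.ediam (t n w) ^ s) atTop (𝓝 0) :=
      tendsto_of_tendsto_of_tendsto_of_le_of_le' tendsto_const_nhds hlim (Eventually.of_forall fun _ => zero_le) hbd
    rw [ht0.liminf_eq] at hle
    exact le_antisymm hle zero_le
  refine le_antisymm ?_ zero_le
  refine ENNReal.le_of_forall_pos_le_add ?_
  intro ε hε _
  rw [zero_add]
  exact dimH_le_of_hausdorffMeasure_ne_top (by rw [key ε (by exact_mod_cast hε)]; simp)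

end main
end Aux

/-- Theorem (dimH part of Theorem 2(i)): if `(a,b) ∈ W`, `q₀,q₁ > 1` and
`π_{q,q}(a) < π_{q,q}(b)` for all `q > 1`, then `h(Ω_{a,b}) = 0` and
`dim_H π_{q₀,q₁}(Ω_{a,b}) = 0`. -/
theorem stmt0 (a b : ℕ → Bool) (q0 q1 : ℝ) (hW : memW a b) (hq0 : 1 < q0) (hq1 : 1 < q1)
    (h : ∀ q : ℝ, 1 < q → piE q q a < piE q q b) :
    entropy a b = 0 ∧ dimH (piE q0 q1 '' Omega a b) = 0 := by
  have e := Aux.ent_zero hW h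
  exact ⟨e, Aux.dim_zero hW q0 q1 hq0 hq1 e⟩
end

section
/- Let (a,b) ∈ W and suppose that π_{q,q}(a) = π_{q,q}(b) for some q > 1. Then there exists a maximal β > 1 with π_{β,β}(a) = π_{β,β}(b), and the topological entropy satisfies h(Ω_{a,b}) = log β. -/
open Filter Topology

def valN : ℕ → (ℕ → Bool) → ℕ
  | 0, _ => 0
  | n + 1, x => (x 0).toNat * 2 ^ n + valN n (shiftTail x 1)

theorem valN_lt (n : ℕ) : ∀ x, valN n x < 2 ^ n := by
  induction n with
  | zero => intro x; simp [valN]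
  | succ n ih =>
    intro x
    have := ih (shiftTail x 1)
    rw [valN, pow_succ]
    cases x 0 <;> simp <;> omega

theorem valN_inj (n : ℕ) : ∀ x y, valN n x = valN n y → ∀ k < n, x k = y k := by
  induction n with
  | zero => intro x y _ k hk; omega
  | succ n ih =>
    intro x y h k hk
    have h1 := valN_lt n (shiftTail x 1)
    have h2 := valN_lt n (shiftTail y 1)
    rw [valN, valN] at h
    have h0 : x 0 = y 0 ∧ valN n (shiftTail x 1) = valN n (shiftTail y 1) := by
      cases hx : x 0 <;> cases hy : y 0 <;> simp [hx, hy] at h ⊢ <;> omega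
    cases k with
    | zero => exact h0.1
    | succ k =>
      have := ih _ _ h0.2 k (by omega)
      simpa [shiftTail, add_comm] using this

theorem valN_congr (n : ℕ) : ∀ x y, (∀ k < n, x k = y k) → valN n x = valN n y := by
  induction n with
  | zero => intro x y _; rfl
  | succ n ih =>
    intro x y h
    rw [valN, valN, h 0 (by omega), ih (shiftTail x 1) (shiftTail y 1)]
    intro k hk
    exact h _ (by omega)

theorem lexLt_of_tail {x y : ℕ → Bool} (h0 : x 0 = y 0)
    (h : lexLt (shiftTail x 1) (shiftTail y 1)) : lexLt x y := by
  obtain ⟨n, h1, h2⟩ := h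
  refine ⟨1 + n, ?_, h2⟩
  intro m hm
  cases m with
  | zero => exact h0
  | succ m => have := h1 m (by omega); simpa [shiftTail, add_comm] using this

theorem lexLt_of_head {x y : ℕ → Bool} (h0 : x 0 = false) (h1 : y 0 = true) : lexLt x y :=
  ⟨0, by intro m hm; omega, by rw [h0, h1]; decide⟩

theorem lexLt_asymm {x y : ℕ → Bool} (h : lexLt x y) (h' : lexLt y x) : False := by
  obtain ⟨n, h1, h2⟩ := h
  obtain ⟨m, h3, h4⟩ := h'
  rcases lt_trichotomy n m with hl | hl | hl
  · rw [h3 n hl] at h2; exact lt_irrefl _ h2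
  · subst hl; exact lt_asymm h2 h4
  · rw [h1 m hl] at h4; exact lt_irrefl _ h4

theorem lexLt_of_valN (n : ℕ) : ∀ x y, valN n x < valN n y → lexLt x y := by
  induction n with
  | zero => intro x y h; simp [valN] at h
  | succ n ih =>
    intro x y h
    have h1 := valN_lt n (shiftTail x 1)
    have h2 := valN_lt n (shiftTail y 1)
    rw [valN, valN] at h
    cases hx : x 0 <;> cases hy : y 0 <;> simp [hx, hy] at h
    · exact lexLt_of_tail (by rw [hx, hy]) (ih _ _ h)
    · exact lexLt_of_head hx hy
    · omega
    · exact lexLt_of_tail (by rw [hx, hy]) (ih _ _ h)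

theorem lexLt_trans {x y z : ℕ → Bool} (h : lexLt x y) (h' : lexLt y z) : lexLt x z := by
  obtain ⟨n, h1, h2⟩ := h
  obtain ⟨m, h3, h4⟩ := h'
  rcases lt_trichotomy n m with hl | hl | hl
  · exact ⟨n, fun k hk => (h1 k hk).trans (h3 k (by omega)), by rw [← h3 n hl]; exact h2⟩
  · subst hl; exact ⟨n, fun k hk => (h1 k hk).trans (h3 k hk), h2.trans h4⟩
  · exact ⟨m, fun k hk => (h1 k (by omega)).trans (h3 k hk), by rw [h1 m hl]; exact h4⟩

theorem shiftTail_zero (x : ℕ → Bool) : shiftTail x 0 = x := by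
  funext k; simp [shiftTail]

theorem shiftTail_shiftTail (x : ℕ → Bool) (m n : ℕ) :
    shiftTail (shiftTail x m) n = shiftTail x (m + n) := by
  funext k; simp [shiftTail, add_assoc]

theorem Omega_tail {a b x : ℕ → Bool} (h : x ∈ Omega a b) (m : ℕ) :
    shiftTail x m ∈ Omega a b := by
  intro n
  rw [shiftTail_shiftTail]
  exact h _

/-- A member of Omega starting with 0 has tail at most the tail of `a` (on prefixes). -/
theorem val_le_a {a b x : ℕ → Bool} (ha : a 0 = false) (hb : b 0 = true) (h : x ∈ Omega a b)
    (h0 : x 0 = false) (n : ℕ) : valN n (shiftTail x 1) ≤ valN n (shiftTail a 1) := by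
  by_contra hc
  have := h 0
  rw [shiftTail_zero] at this
  exact this ⟨lexLt_of_tail (by rw [ha, h0]) (lexLt_of_valN n _ _ (by omega)),
    lexLt_of_head h0 hb⟩

theorem val_ge_b {a b x : ℕ → Bool} (ha : a 0 = false) (hb : b 0 = true) (h : x ∈ Omega a b)
    (h0 : x 0 = true) (n : ℕ) : valN n (shiftTail b 1) ≤ valN n (shiftTail x 1) := by
  by_contra hc
  have := h 0
  rw [shiftTail_zero] at this
  exact this ⟨lexLt_of_head ha h0,
    lexLt_of_tail (by rw [hb, h0]) (lexLt_of_valN n _ _ (by omega))⟩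

def consB (d : Bool) (y : ℕ → Bool) : ℕ → Bool
  | 0 => d
  | k + 1 => y k

theorem shiftTail_consB (d : Bool) (y : ℕ → Bool) : shiftTail (consB d y) 1 = y := by
  funext k; simp [shiftTail, add_comm, consB]

theorem cons_mem {a b y : ℕ → Bool} {d : Bool} (hy : y ∈ Omega a b)
    (h : ¬ (lexLt a (consB d y) ∧ lexLt (consB d y) b)) : consB d y ∈ Omega a b := by
  intro n
  cases n with
  | zero => rw [shiftTail_zero]; exact h
  | succ n =>
    rw [add_comm, ← shiftTail_shiftTail, shiftTail_consB]
    exact hy n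

open Classical in
noncomputable def VV (a b : ℕ → Bool) (n : ℕ) : Finset ℕ :=
  (Finset.range (2 ^ n)).filter (fun v => ∃ i ∈ Omega a b, valN n i = v)

theorem mem_VV {a b : ℕ → Bool} {n v : ℕ} : v ∈ VV a b n ↔ ∃ i ∈ Omega a b, valN n i = v := by
  simp only [VV, Finset.mem_filter, Finset.mem_range, and_iff_right_iff_imp]
  rintro ⟨i, _, rfl⟩
  exact valN_lt n i

theorem card_VV (a b : ℕ → Bool) (n : ℕ) : (Lwords a b n).card = (VV a b n).card := by
  have key : ∀ (w : Fin n → Bool) (k : ℕ) (hk : k < n),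
      (if h : k < n then w ⟨k, h⟩ else false) = w ⟨k, hk⟩ := by
    intro w k hk; simp [hk]
  refine Finset.card_bij (fun w _ => valN n (fun k => if h : k < n then w ⟨k, h⟩ else false))
    ?_ ?_ ?_
  · intro w hw
    simp only [Lwords, Set.Finite.mem_toFinset, Set.mem_ofPred_eq] at hw
    obtain ⟨i, hi, hw⟩ := hw
    refine mem_VV.2 ⟨i, hi, valN_congr _ _ _ ?_⟩
    intro k hk
    rw [key w k hk]; exact hw ⟨k, hk⟩
  · intro w _ w' _ h
    funext k
    have := valN_inj _ _ _ h k.1 k.2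
    rwa [key w k.1 k.2, key w' k.1 k.2] at this
  · intro v hv
    obtain ⟨i, hi, rfl⟩ := mem_VV.1 hv
    refine ⟨fun k => i k.1, ?_, ?_⟩
    · simp only [Lwords, Set.Finite.mem_toFinset, Set.mem_ofPred_eq]
      exact ⟨i, hi, fun _ => rfl⟩
    · refine valN_congr _ _ _ ?_
      intro k hk
      exact key (fun k => i k.1) k hk

theorem mem_VV_succ {a b : ℕ → Bool} (hW : memW a b) (n v : ℕ) :
    v ∈ VV a b (n + 1) ↔ (v ∈ VV a b n ∧ v ≤ valN n (shiftTail a 1)) ∨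
      (∃ w ∈ VV a b n, valN n (shiftTail b 1) ≤ w ∧ 2 ^ n + w = v) := by
  obtain ⟨ha, hb, haO, hbO⟩ := hW
  constructor
  · intro hv
    obtain ⟨i, hi, rfl⟩ := mem_VV.1 hv
    cases h0 : i 0
    · left
      rw [valN, h0]
      simp only [Bool.toNat_false, zero_mul, zero_add]
      exact ⟨mem_VV.2 ⟨_, Omega_tail hi 1, rfl⟩, val_le_a ha hb hi h0 n⟩
    · right
      rw [valN, h0]
      refine ⟨_, mem_VV.2 ⟨_, Omega_tail hi 1, rfl⟩, val_ge_b ha hb hi h0 n, by simp⟩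
  · rintro (⟨hv, hle⟩ | ⟨w, hw, hle, rfl⟩)
    · rcases hle.eq_or_lt with h | h
      · refine mem_VV.2 ⟨a, haO, ?_⟩
        rw [valN, ha, h]; simp
      · obtain ⟨y, hy, rfl⟩ := mem_VV.1 hv
        refine mem_VV.2 ⟨consB false y, cons_mem hy ?_, ?_⟩
        · rintro ⟨h1, -⟩
          refine lexLt_asymm h1 (lexLt_of_tail (by rw [ha]; rfl) ?_)
          rw [shiftTail_consB]; exact lexLt_of_valN n _ _ h
        · rw [valN, shiftTail_consB]; simp [consB]
    · rcases hle.eq_or_lt with h | h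
      · refine mem_VV.2 ⟨b, hbO, ?_⟩
        rw [valN, hb, h]; simp
      · obtain ⟨y, hy, rfl⟩ := mem_VV.1 hw
        refine mem_VV.2 ⟨consB true y, cons_mem hy ?_, ?_⟩
        · rintro ⟨-, h1⟩
          refine lexLt_asymm h1 (lexLt_of_tail (by rw [hb]; rfl) ?_)
          rw [shiftTail_consB]; exact lexLt_of_valN n _ _ h
        · rw [valN, shiftTail_consB]; simp [consB]

noncomputable def CC (a b : ℕ → Bool) (n : ℕ) (x : ℕ → Bool) : ℕ :=
  ((VV a b n).filter (fun v => v < valN n x)).card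

noncomputable def DD (a b : ℕ → Bool) (n : ℕ) : ℝ :=
  (CC a b n (shiftTail a 1) : ℝ) + 1 - CC a b n (shiftTail b 1)

theorem val_mem {a b x : ℕ → Bool} (hx : x ∈ Omega a b) (n : ℕ) : valN n x ∈ VV a b n :=
  mem_VV.2 ⟨x, hx, rfl⟩

theorem card_le_val {a b x : ℕ → Bool} (hx : x ∈ Omega a b) (n : ℕ) :
    ((VV a b n).filter (fun v => v ≤ valN n x)).card = CC a b n x + 1 := by
  have : (VV a b n).filter (fun v => v ≤ valN n x) =
      insert (valN n x) ((VV a b n).filter (fun v => v < valN n x)) := by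
    ext v
    simp only [Finset.mem_filter, Finset.mem_insert]
    have := val_mem hx n
    constructor
    · rintro ⟨h1, h2⟩
      rcases h2.eq_or_lt with h | h
      · exact Or.inl h
      · exact Or.inr ⟨h1, h⟩
    · rintro (rfl | ⟨h1, h2⟩)
      · exact ⟨this, le_rfl⟩
      · exact ⟨h1, h2.le⟩
  rw [this, Finset.card_insert_of_notMem (by simp)]
  rfl

theorem CC_succ {a b : ℕ → Bool} (hW : memW a b) {x : ℕ → Bool} (hx : x ∈ Omega a b) (n : ℕ) :
    (CC a b (n + 1) x : ℝ) =
      CC a b n (shiftTail x 1) + (if x 0 then (1 : ℝ) else 0) * DD a b n := by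
  obtain ⟨ha, hb, haO, hbO⟩ := id hW
  cases h0 : x 0
  · have : CC a b (n + 1) x = CC a b n (shiftTail x 1) := by
      unfold CC
      congr 1
      ext v
      have h1 := valN_lt n (shiftTail x 1)
      have h2 := val_le_a ha hb hx h0 n
      simp only [Finset.mem_filter, mem_VV_succ hW, valN, h0, Bool.toNat_false, zero_mul,
        zero_add]
      constructor
      · rintro ⟨⟨h3, h4⟩ | ⟨w, h3, h4, rfl⟩, h5⟩
        · exact ⟨h3, h5⟩
        · omega
      · rintro ⟨h3, h4⟩
        exact ⟨Or.inl ⟨h3, by omega⟩, h4⟩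
    rw [this]; simp
  · have h2 := val_ge_b ha hb hx h0 n
    have e1 : (VV a b (n + 1)).filter (fun v => v < valN (n + 1) x) =
        (VV a b n).filter (fun v => v ≤ valN n (shiftTail a 1)) ∪
        ((VV a b n).filter (fun v => valN n (shiftTail b 1) ≤ v ∧
          v < valN n (shiftTail x 1))).image (fun w => 2 ^ n + w) := by
      ext v
      have h1 := valN_lt n (shiftTail a 1)
      simp only [Finset.mem_filter, Finset.mem_union, Finset.mem_image, mem_VV_succ hW, valN, h0,
        Bool.toNat_true, one_mul]
      constructor
      · rintro ⟨⟨h3, h4⟩ | ⟨w, h3, h4, rfl⟩, h5⟩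
        · exact Or.inl ⟨h3, h4⟩
        · exact Or.inr ⟨w, ⟨h3, h4, by omega⟩, rfl⟩
      · rintro (⟨h3, h4⟩ | ⟨w, ⟨h3, h4, h5⟩, rfl⟩)
        · exact ⟨Or.inl ⟨h3, h4⟩, by omega⟩
        · exact ⟨Or.inr ⟨w, h3, h4, rfl⟩, by omega⟩
    have e2 : CC a b (n + 1) x = (CC a b n (shiftTail a 1) + 1) +
        ((VV a b n).filter (fun v => valN n (shiftTail b 1) ≤ v ∧
          v < valN n (shiftTail x 1))).card := by
      rw [CC, e1, Finset.card_union_of_disjoint, card_le_val (Omega_tail haO 1),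
        Finset.card_image_of_injective]
      · intro u v h; simpa using h
      · rw [Finset.disjoint_left]
        intro v hv hv'
        simp only [Finset.mem_filter, Finset.mem_image] at hv hv'
        obtain ⟨w, _, rfl⟩ := hv'
        have h1 := valN_lt n (shiftTail a 1)
        omega
    have e3 : CC a b n (shiftTail x 1) = CC a b n (shiftTail b 1) +
        ((VV a b n).filter (fun v => valN n (shiftTail b 1) ≤ v ∧
          v < valN n (shiftTail x 1))).card := by
      rw [CC, CC, ← Finset.card_union_of_disjoint]
      · congr 1
        ext v
        simp only [Finset.mem_filter, Finset.mem_union]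
        constructor
        · rintro ⟨h3, h4⟩
          by_cases h5 : v < valN n (shiftTail b 1)
          · exact Or.inl ⟨h3, h5⟩
          · exact Or.inr ⟨h3, by omega, h4⟩
        · rintro (⟨h3, h4⟩ | ⟨h3, h4, h5⟩)
          · exact ⟨h3, by omega⟩
          · exact ⟨h3, h5⟩
      · rw [Finset.disjoint_left]
        intro v hv hv'
        simp only [Finset.mem_filter] at hv hv'
        omega
    rw [e2, DD, e3]
    push_cast
    simp only [if_true]
    ring

theorem CC_eq {a b : ℕ → Bool} (hW : memW a b) (n : ℕ) : ∀ {x : ℕ → Bool}, x ∈ Omega a b →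
    (CC a b n x : ℝ) =
      ∑ k ∈ Finset.range n, (if x k then (1 : ℝ) else 0) * DD a b (n - 1 - k) := by
  induction n with
  | zero => intro x _; simp [CC, valN]
  | succ n ih =>
    intro x hx
    rw [CC_succ hW hx, ih (Omega_tail hx 1), Finset.sum_range_succ']
    congr 1
    refine Finset.sum_congr rfl ?_
    intro k hk
    have : n - 1 - k = n + 1 - 1 - (k + 1) := by omega
    rw [this]
    simp [shiftTail, add_comm]

noncomputable def ee (a b : ℕ → Bool) (k : ℕ) : ℝ :=
  (if b k then (1 : ℝ) else 0) - (if a k then (1 : ℝ) else 0)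

theorem conv_eq {a b : ℕ → Bool} (hW : memW a b) (n : ℕ) :
    ∑ k ∈ Finset.range (n + 1), ee a b k * DD a b (n - k) = 1 := by
  obtain ⟨ha, hb, haO, hbO⟩ := id hW
  have h1 := CC_eq hW (n + 1) haO
  have h2 := CC_eq hW (n + 1) hbO
  have h3 := CC_succ hW haO n
  have h4 := CC_succ hW hbO n
  simp only [ha, hb, if_true, Nat.add_sub_cancel] at h1 h2 h3 h4
  simp only [ee, sub_mul, Finset.sum_sub_distrib]
  rw [← h1, ← h2, h3, h4, DD]
  simp

theorem ones_mem {a b : ℕ → Bool} : (fun _ => true) ∈ Omega a b := by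
  rintro n ⟨-, k, -, h⟩
  exact absurd h (by cases b k <;> simp [shiftTail])

theorem card_eq {a b : ℕ → Bool} (hW : memW a b) (n : ℕ) :
    ((Lwords a b n).card : ℝ) = 1 + ∑ k ∈ Finset.range n, DD a b k := by
  have h1 := CC_eq hW n (ones_mem (a := a) (b := b))
  have h2 := card_le_val (ones_mem (a := a) (b := b)) n
  have h3 : (VV a b n).filter (fun v => v ≤ valN n (fun _ => true)) = VV a b n := by
    refine Finset.filter_true_of_mem ?_
    intro v hv
    obtain ⟨i, _, rfl⟩ := mem_VV.1 hv
    by_contra hc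
    obtain ⟨k, -, h⟩ := lexLt_of_valN n _ _ (not_le.1 hc)
    exact absurd h (by cases i k <;> simp)
  rw [card_VV, ← h3, h2]
  push_cast
  rw [h1]
  simp only [if_true, one_mul]
  rw [Finset.sum_range_reflect (fun k => DD a b k) n]
  ring

theorem mem_Lwords {a b : ℕ → Bool} {n : ℕ} {w : Fin n → Bool} :
    w ∈ Lwords a b n ↔ ∃ i ∈ Omega a b, ∀ k : Fin n, i k.1 = w k := by
  simp [Lwords]

theorem card_pos {a b : ℕ → Bool} (n : ℕ) : 1 ≤ (Lwords a b n).card :=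
  Finset.card_pos.2 ⟨fun _ => true, mem_Lwords.2 ⟨_, ones_mem, fun _ => rfl⟩⟩

theorem card_mono {a b : ℕ → Bool} (n : ℕ) :
    (Lwords a b n).card ≤ (Lwords a b (n + 1)).card := by
  refine Finset.card_le_card_of_surjOn (fun w k => w k.castSucc) ?_
  intro w hw
  obtain ⟨i, hi, h⟩ := mem_Lwords.1 hw
  exact ⟨fun k => i k.1, mem_Lwords.2 ⟨i, hi, fun _ => rfl⟩, funext fun k => h k⟩

theorem card_submul {a b : ℕ → Bool} (m n : ℕ) :
    (Lwords a b (m + n)).card ≤ (Lwords a b m).card * (Lwords a b n).card := by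
  rw [← Finset.card_product]
  refine Finset.card_le_card_of_injOn
    (fun w => (fun k => w (Fin.castAdd n k), fun k => w (Fin.natAdd m k))) ?_ ?_
  · intro w hw
    obtain ⟨i, hi, h⟩ := mem_Lwords.1 hw
    refine Finset.mem_product.2 ⟨mem_Lwords.2 ⟨i, hi, fun k => h (Fin.castAdd n k)⟩,
      mem_Lwords.2 ⟨shiftTail i m, Omega_tail hi m, fun k => h (Fin.natAdd m k)⟩⟩
  · intro w _ w' _ h
    simp only [Prod.mk.injEq] at h
    funext k
    refine Fin.addCases (fun k => congrFun h.1 k) (fun k => congrFun h.2 k) k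

theorem DD_eq {a b : ℕ → Bool} (hW : memW a b) (n : ℕ) :
    DD a b n = (Lwords a b (n + 1)).card - (Lwords a b n).card := by
  rw [card_eq hW, card_eq hW, Finset.sum_range_succ]; ring

theorem DD_nonneg {a b : ℕ → Bool} (hW : memW a b) (n : ℕ) : 0 ≤ DD a b n := by
  rw [DD_eq hW, sub_nonneg]
  exact_mod_cast card_mono n

theorem DD_le {a b : ℕ → Bool} (hW : memW a b) (n : ℕ) :
    DD a b n ≤ (Lwords a b (n + 1)).card := by
  rw [DD_eq hW]; simp

/-- Entropy facts. -/
theorem ent_facts (a b : ℕ → Bool) :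
    Tendsto (fun n : ℕ => Real.log ((Lwords a b n).card) / n) atTop (𝓝 (entropy a b)) ∧
    (∀ n : ℕ, 1 ≤ ((Lwords a b n).card : ℝ) * Real.exp (-entropy a b) ^ n) ∧
    0 ≤ entropy a b := by
  have hpos : ∀ n, (1 : ℝ) ≤ (Lwords a b n).card := fun n => by exact_mod_cast card_pos n
  have hsub : Subadditive (fun n : ℕ => Real.log ((Lwords a b n).card)) := by
    intro m n
    have h1 := hpos m
    have h2 := hpos n
    have h3 := hpos (m + n)
    simp only
    rw [← Real.log_mul (by linarith) (by linarith)]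
    refine Real.log_le_log (by linarith) ?_
    exact_mod_cast card_submul m n
  have hnn : ∀ n : ℕ, 0 ≤ Real.log ((Lwords a b n).card) / n := fun n =>
    div_nonneg (Real.log_nonneg (hpos n)) (Nat.cast_nonneg n)
  have hbdd : BddBelow (Set.range fun n : ℕ => Real.log ((Lwords a b n).card) / n) :=
    ⟨0, by rintro _ ⟨n, rfl⟩; exact hnn n⟩
  have ht := hsub.tendsto_lim hbdd
  have he : entropy a b = hsub.lim := ht.limsup_eq
  rw [← he] at ht
  refine ⟨ht, ?_, ge_of_tendsto' ht hnn⟩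
  intro n
  rcases Nat.eq_zero_or_pos n with rfl | hn
  · simpa using hpos 0
  · have h1 := hsub.lim_le_div hbdd (n := n) (by omega)
    rw [← he, le_div_iff₀ (by exact_mod_cast hn)] at h1
    have h2 := Real.exp_le_exp.2 h1
    rw [Real.exp_log (by linarith [hpos n])] at h2
    have h3 : Real.exp (-entropy a b) ^ n = Real.exp (-(entropy a b * n)) := by
      rw [← Real.exp_nat_mul]; ring_nf
    rw [h3]
    calc (1 : ℝ) = Real.exp (entropy a b * n) * Real.exp (-(entropy a b * n)) := by
          rw [← Real.exp_add]; simp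
      _ ≤ _ := by gcongr

theorem summable_card (a b : ℕ → Bool) {z : ℝ} (hz : 0 < z) (hz' : z < Real.exp (-entropy a b)) :
    Summable (fun n : ℕ => ((Lwords a b n).card : ℝ) * z ^ n) := by
  have hpos : ∀ n, (1 : ℝ) ≤ (Lwords a b n).card := fun n => by exact_mod_cast card_pos n
  have h1 : entropy a b < -Real.log z := by
    have := (Real.log_lt_log hz hz')
    rw [Real.log_exp] at this
    linarith
  obtain ⟨c, hc1, hc2⟩ := exists_between h1
  have hev := (ent_facts a b).1.eventually_lt_const hc1
  have hg : Summable (fun n : ℕ => (Real.exp (c + Real.log z)) ^ n) := by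
    refine summable_geometric_of_lt_one (Real.exp_pos _).le ?_
    rw [Real.exp_lt_one_iff]; linarith
  refine Summable.of_norm_bounded_eventually_nat hg ?_
  filter_upwards [hev, eventually_gt_atTop 0] with n hn hn0
  rw [Real.norm_of_nonneg (by positivity), Real.exp_add, Real.exp_log hz, mul_pow]
  rw [div_lt_iff₀ (by exact_mod_cast hn0), Real.log_lt_iff_lt_exp (by linarith [hpos n])] at hn
  have : Real.exp c ^ n = Real.exp (c * n) := by rw [← Real.exp_nat_mul]; ring_nf
  rw [this]
  gcongr

theorem summable_DD {a b : ℕ → Bool} (hW : memW a b) {z : ℝ} (hz : 0 < z)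
    (hz' : z < Real.exp (-entropy a b)) : Summable (fun n : ℕ => DD a b n * z ^ n) := by
  have h1 := ((summable_nat_add_iff 1).2 (summable_card a b hz hz')).mul_right z⁻¹
  refine Summable.of_nonneg_of_le (fun n => mul_nonneg (DD_nonneg hW n) (by positivity)) ?_ h1
  intro n
  have : ((Lwords a b (n + 1)).card : ℝ) * z ^ (n + 1) * z⁻¹ = (Lwords a b (n + 1)).card * z ^ n := by
    rw [pow_succ]; field_simp
  rw [this]
  have := DD_le hW n
  gcongr

noncomputable def ff (a b : ℕ → Bool) (z : ℝ) : ℝ := ∑' k, ee a b k * z ^ k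

theorem ee_abs (a b : ℕ → Bool) (k : ℕ) : |ee a b k| ≤ 1 := by
  unfold ee; cases a k <;> cases b k <;> simp

theorem summable_ee (a b : ℕ → Bool) {z : ℝ} (hz : 0 ≤ z) (hz' : z < 1) :
    Summable (fun n : ℕ => ‖ee a b n * z ^ n‖) := by
  refine Summable.of_nonneg_of_le (fun n => norm_nonneg _) ?_ (summable_geometric_of_lt_one hz hz')
  intro n
  rw [norm_mul, Real.norm_eq_abs, Real.norm_of_nonneg (by positivity)]
  exact mul_le_of_le_one_left (by positivity) (ee_abs a b n)

theorem ff_mul {a b : ℕ → Bool} (hW : memW a b) {z : ℝ} (hz : 0 < z) (hz1 : z < 1)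
    (hz' : z < Real.exp (-entropy a b)) :
    ff a b z * (∑' n, DD a b n * z ^ n) = (1 - z)⁻¹ := by
  rw [ff, tsum_mul_tsum_eq_tsum_sum_range_of_summable_norm (summable_ee a b hz.le hz1)
    (summable_DD hW hz hz').norm, ← tsum_geometric_of_lt_one hz.le hz1]
  refine tsum_congr fun n => ?_
  have := conv_eq hW n
  calc _ = ∑ k ∈ Finset.range (n + 1), (ee a b k * DD a b (n - k)) * z ^ n := by
        refine Finset.sum_congr rfl fun k hk => ?_
        have : k + (n - k) = n := by simp at hk; omega
        have h5 : z ^ n = z ^ k * z ^ (n - k) := by rw [← pow_add, this]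
        rw [h5]; ring
    _ = z ^ n := by rw [← Finset.sum_mul, this, one_mul]

theorem ff_cont (a b : ℕ → Bool) {r : ℝ} (hr : 0 ≤ r) (hr1 : r < 1) :
    ContinuousOn (ff a b) (Set.Icc 0 r) := by
  refine continuousOn_tsum (u := fun n => r ^ n) (fun n => by fun_prop)
    (summable_geometric_of_lt_one hr hr1) ?_
  intro n z hz
  rw [norm_mul, Real.norm_eq_abs, Real.norm_of_nonneg (pow_nonneg hz.1 _)]
  calc _ ≤ 1 * z ^ n := by
        have := ee_abs a b n
        have := hz.1
        gcongr
    _ ≤ r ^ n := by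
        rw [one_mul]
        exact pow_le_pow_left₀ hz.1 hz.2 n

theorem ff_zero {a b : ℕ → Bool} (hW : memW a b) : ff a b 0 = 1 := by
  rw [ff, tsum_eq_single 0]
  · simp [ee, hW.1, hW.2.1]
  · intro n hn; simp [hn]

theorem piE_iff (a b : ℕ → Bool) {q : ℝ} (hq : 1 < q) :
    piE q q a = piE q q b ↔ ff a b q⁻¹ = 0 := by
  have hq0 : 0 < q := by linarith
  have hz : 0 ≤ q⁻¹ := by positivity
  have hz1 : q⁻¹ < 1 := inv_lt_one_of_one_lt₀ hq
  have e : ∀ x : ℕ → Bool, piE q q x = q⁻¹ * ∑' k, (if x k then (1 : ℝ) else 0) * q⁻¹ ^ k := by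
    intro x
    rw [piE, ← tsum_mul_left]
    refine tsum_congr fun k => ?_
    have : ∀ d, qb q q d = q := by intro d; cases d <;> simp [qb]
    simp only [this, Finset.prod_const, Finset.card_range]
    rw [div_eq_mul_inv, pow_succ, mul_inv, inv_pow]; ring
  have s : ∀ x : ℕ → Bool, Summable fun k => (if x k then (1 : ℝ) else 0) * q⁻¹ ^ k := by
    intro x
    refine Summable.of_nonneg_of_le (fun n => by positivity) ?_
      (summable_geometric_of_lt_one hz hz1)
    intro n
    cases x n <;> simp; positivity
  have : ff a b q⁻¹ = (∑' k, (if b k then (1 : ℝ) else 0) * q⁻¹ ^ k) -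
      ∑' k, (if a k then (1 : ℝ) else 0) * q⁻¹ ^ k := by
    rw [← (s b).tsum_sub (s a), ff]
    refine tsum_congr fun k => ?_
    rw [ee]; ring
  rw [this, e, e, sub_eq_zero, mul_right_inj' (by positivity)]
  exact eq_comm

theorem upper {a b : ℕ → Bool} (hW : memW a b) {z₀ : ℝ} (hz1 : z₀ < 1)
    (hpos : ∀ z, 0 ≤ z → z < z₀ → 0 < ff a b z) : z₀ ≤ Real.exp (-entropy a b) := by
  by_contra hc
  push Not at hc
  set r := Real.exp (-entropy a b) with hr
  have hr0 : 0 < r := Real.exp_pos _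
  have hr1 : r < 1 := hc.trans hz1
  obtain ⟨w, hw, hmin⟩ := isCompact_Icc.exists_isMinOn (Set.nonempty_Icc.2 hr0.le)
    (ff_cont a b hr0.le hr1)
  have hm : 0 < ff a b w := hpos w hw.1 (hw.2.trans_lt hc)
  set m := ff a b w
  have hb : ∀ z, 0 < z → z < r → ∀ N : ℕ,
      ∑ n ∈ Finset.range N, DD a b n * z ^ n ≤ (1 - r)⁻¹ / m := by
    intro z hz hzr N
    have h1 := ff_mul hW hz (hzr.trans hr1) hzr
    have hnn : ∀ n, 0 ≤ DD a b n * z ^ n := fun n =>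
      mul_nonneg (DD_nonneg hW n) (by positivity)
    have h2 := (summable_DD hW hz hzr).sum_le_tsum (Finset.range N) (fun n _ => hnn n)
    have h3 : m ≤ ff a b z := hmin (show z ∈ Set.Icc 0 r from ⟨hz.le, hzr.le⟩)
    refine h2.trans ?_
    rw [le_div_iff₀ hm]
    calc _ ≤ (∑' n, DD a b n * z ^ n) * ff a b z :=
          mul_le_mul_of_nonneg_left h3 (tsum_nonneg hnn)
      _ = (1 - z)⁻¹ := by rw [mul_comm, h1]
      _ ≤ (1 - r)⁻¹ := by
          apply inv_anti₀ <;> linarith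
  have hb' : ∀ N : ℕ, ∑ n ∈ Finset.range N, DD a b n * r ^ n ≤ (1 - r)⁻¹ / m := by
    intro N
    have hcont : Continuous (fun z : ℝ => ∑ n ∈ Finset.range N, DD a b n * z ^ n) := by fun_prop
    have ht : Tendsto (fun z : ℝ => ∑ n ∈ Finset.range N, DD a b n * z ^ n) (𝓝[<] r)
        (𝓝 (∑ n ∈ Finset.range N, DD a b n * r ^ n)) :=
      (hcont.tendsto r).mono_left nhdsWithin_le_nhds
    refine le_of_tendsto ht ?_
    filter_upwards [Ioo_mem_nhdsLT hr0] with z hz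
    exact hb z hz.1 hz.2 N
  have hs : Summable (fun n => DD a b n * r ^ n) :=
    summable_of_sum_range_le (fun n => mul_nonneg (DD_nonneg hW n) (by positivity)) hb'
  have hg := summable_geometric_of_lt_one hr0.le hr1
  have hcv := (summable_norm_sum_mul_range_of_summable_norm hs.norm hg.norm).of_norm
  have hL : Summable (fun n : ℕ => ((Lwords a b (n + 1)).card : ℝ) * r ^ (n + 1)) := by
    refine (((summable_nat_add_iff 1).2 hg).add (hcv.mul_left r)).congr ?_
    intro n
    rw [card_eq hW, add_mul, one_mul, Finset.sum_mul, Finset.mul_sum]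
    congr 1
    refine Finset.sum_congr rfl fun k hk => ?_
    have : n + 1 = 1 + k + (n - k) := by simp at hk; omega
    have h5 : r ^ (n + 1) = r * r ^ k * r ^ (n - k) := by rw [this, pow_add, pow_add, pow_one]
    rw [h5]; ring
  have h0 := hL.tendsto_atTop_zero
  have := ge_of_tendsto' h0 (fun n => (ent_facts a b).2.1 (n + 1))
  linarith

theorem stmt1 (a b : ℕ → Bool) (hW : memW a b)
    (h : ∃ q : ℝ, 1 < q ∧ piE q q a = piE q q b) :
    ∃ β : ℝ, 1 < β ∧ piE β β a = piE β β b ∧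
      (∀ q : ℝ, β < q → piE q q a ≠ piE q q b) ∧
      entropy a b = Real.log β := by
  obtain ⟨q, hq, hqe⟩ := h
  rw [piE_iff a b hq] at hqe
  have hq0 : 0 < q⁻¹ := by positivity
  have hq1 : q⁻¹ < 1 := inv_lt_one_of_one_lt₀ hq
  have hcont := ff_cont a b hq0.le hq1
  have hcl : IsClosed (Set.Icc 0 q⁻¹ ∩ ff a b ⁻¹' {0}) :=
    hcont.preimage_isClosed_of_isClosed isClosed_Icc isClosed_singleton
  have hcomp : IsCompact (Set.Icc 0 q⁻¹ ∩ ff a b ⁻¹' {0}) :=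
    isCompact_Icc.of_isClosed_subset hcl Set.inter_subset_left
  obtain ⟨z₀, ⟨⟨hz0, hzq⟩, hfz⟩, hleast⟩ := hcomp.exists_isLeast ⟨q⁻¹, ⟨hq0.le, le_rfl⟩, hqe⟩
  have hfz : ff a b z₀ = 0 := hfz
  have hz0 : 0 < z₀ := by
    rcases hz0.eq_or_lt with h | h
    · rw [← h, ff_zero hW] at hfz; norm_num at hfz
    · exact h
  have hz1 : z₀ < 1 := hzq.trans_lt hq1
  have hne : ∀ z, 0 ≤ z → z < z₀ → ff a b z ≠ 0 := by
    intro z h1 h2 h3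
    exact absurd (hleast ⟨⟨h1, h2.le.trans hzq⟩, h3⟩) (not_le.2 h2)
  have hpos : ∀ z, 0 ≤ z → z < z₀ → 0 < ff a b z := by
    intro z h1 h2
    by_contra hc
    push Not at hc
    have hiv := intermediate_value_Icc' h1
      (hcont.mono (Set.Icc_subset_Icc_right (h2.le.trans hzq)))
    obtain ⟨y, hy, hy0⟩ := hiv (show (0 : ℝ) ∈ Set.Icc (ff a b z) (ff a b 0) from
      ⟨hc, by rw [ff_zero hW]; norm_num⟩)
    exact hne y hy.1 (hy.2.trans_lt h2) hy0
  have hexp : Real.exp (-entropy a b) = z₀ := by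
    refine le_antisymm ?_ (upper hW hz1 hpos)
    by_contra hc
    push Not at hc
    have := ff_mul hW hz0 hz1 hc
    rw [hfz, zero_mul] at this
    have : 0 < (1 - z₀)⁻¹ := inv_pos.2 (by linarith)
    linarith
  have hβ : 1 < z₀⁻¹ := (one_lt_inv₀ hz0).2 hz1
  refine ⟨z₀⁻¹, hβ, ?_, ?_, ?_⟩
  · rw [piE_iff a b hβ, inv_inv]; exact hfz
  · intro p hp
    have hp1 : 1 < p := hβ.trans hp
    rw [Ne, piE_iff a b hp1]
    have hp0 : 0 < p := by linarith
    exact hne _ (by positivity) (inv_lt_of_inv_lt₀ hz0 hp)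
  · rw [Real.log_inv, ← hexp, Real.log_exp, neg_neg]
end

section
/- Let (a,b) ∈ W, let q₀,q₁ > 1, and suppose that π_{q,q}(a) = π_{q,q}(b) for some q > 1. Then there exists a maximal s > 0 such that π_{q₀^s,q₁^s}(a) = π_{q₀^s,q₁^s}(b), and dim_H π_{q₀,q₁}(Ω_{a,b}) = min{1, s}. -/
open Filter Topology

/-! ### Basic facts on `piE` -/

lemma qb_ge {m Q0 Q1 : ℝ} (h0 : m ≤ Q0) (h1 : m ≤ Q1) (d : Bool) : m ≤ qb Q0 Q1 d := by
  unfold qb; split_ifs <;> assumption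

lemma qb_gt_one {Q0 Q1 : ℝ} (h0 : 1 < Q0) (h1 : 1 < Q1) (d : Bool) : 1 < qb Q0 Q1 d := by
  unfold qb; split_ifs <;> assumption

lemma term_bound {m Q0 Q1 : ℝ} (hm : 1 < m) (h0 : m ≤ Q0) (h1 : m ≤ Q1) (u : ℕ → Bool) (k : ℕ) :
    ‖(if u k then (1 : ℝ) else 0) / ∏ j ∈ Finset.range (k + 1), qb Q0 Q1 (u j)‖
      ≤ (m⁻¹) ^ (k + 1) := by
  have hp : m ^ (k + 1) ≤ ∏ j ∈ Finset.range (k + 1), qb Q0 Q1 (u j) := by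
    have := Finset.prod_le_prod (s := Finset.range (k + 1)) (f := fun _ => m)
      (g := fun j => qb Q0 Q1 (u j)) (fun i _ => by linarith) (fun i _ => qb_ge h0 h1 _)
    simpa using this
  have hm0 : 0 < m ^ (k + 1) := by positivity
  rw [norm_div, inv_pow, div_eq_mul_inv]
  have h3 : ‖(if u k then (1 : ℝ) else 0)‖ ≤ 1 := by split_ifs <;> simp
  have h4 : ‖∏ j ∈ Finset.range (k + 1), qb Q0 Q1 (u j)‖⁻¹ ≤ (m ^ (k + 1))⁻¹ := by
    apply inv_anti₀ hm0
    rw [Real.norm_of_nonneg (hm0.le.trans hp)]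
    exact hp
  calc _ ≤ 1 * (m ^ (k + 1))⁻¹ := by gcongr
    _ = _ := one_mul _

lemma summable_geo {m : ℝ} (hm : 1 < m) : Summable (fun k : ℕ => (m⁻¹) ^ (k + 1)) := by
  have h : m⁻¹ < 1 := inv_lt_one_of_one_lt₀ hm
  have h0 : 0 ≤ m⁻¹ := by positivity
  exact (summable_nat_add_iff 1).2 (summable_geometric_of_lt_one h0 h)

lemma summable_term {Q0 Q1 : ℝ} (h0 : 1 < Q0) (h1 : 1 < Q1) (u : ℕ → Bool) :
    Summable (fun k : ℕ => (if u k then (1 : ℝ) else 0) /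
      ∏ j ∈ Finset.range (k + 1), qb Q0 Q1 (u j)) :=
  Summable.of_norm_bounded (summable_geo (lt_min h0 h1))
    (fun k => term_bound (lt_min h0 h1) (min_le_left _ _) (min_le_right _ _) u k)

/-- Prepend a digit. -/
def cs (d : Bool) (u : ℕ → Bool) : ℕ → Bool
  | 0 => d
  | n + 1 => u n

@[simp] lemma cs_zero (d : Bool) (u : ℕ → Bool) : cs d u 0 = d := rfl
@[simp] lemma cs_succ (d : Bool) (u : ℕ → Bool) (n : ℕ) : cs d u (n + 1) = u n := rfl

lemma cs_shift (u : ℕ → Bool) : cs (u 0) (shiftTail u 1) = u := by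
  funext n
  cases n with
  | zero => rfl
  | succ n => simp [shiftTail, add_comm]

lemma shift_cs (d : Bool) (u : ℕ → Bool) (n : ℕ) : shiftTail (cs d u) (n + 1) = shiftTail u n := by
  funext k
  simp only [shiftTail]
  rw [show n + 1 + k = (n + k) + 1 by ring]; rfl

@[simp] lemma shift_zero (u : ℕ → Bool) : shiftTail u 0 = u := by
  funext k; simp [shiftTail]

lemma shift_shift (u : ℕ → Bool) (m n : ℕ) :
    shiftTail (shiftTail u m) n = shiftTail u (m + n) := by
  funext k; simp [shiftTail, add_assoc]

/-- value of a digit -/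
noncomputable def dv (d : Bool) : ℝ := if d then 1 else 0

lemma piE_cs {Q0 Q1 : ℝ} (h0 : 1 < Q0) (h1 : 1 < Q1) (d : Bool) (u : ℕ → Bool) :
    piE Q0 Q1 (cs d u) = (dv d + piE Q0 Q1 u) / qb Q0 Q1 d := by
  unfold piE
  rw [(summable_term h0 h1 (cs d u)).tsum_eq_zero_add]
  simp only [Finset.prod_range_succ' _ (_ + 1), cs_zero, cs_succ, zero_add,
    Finset.prod_range_one, dv, add_div]
  congr 1
  rw [← tsum_div_const]
  congr 1
  funext k
  rw [div_div]
  rfl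

lemma piE_eq {Q0 Q1 : ℝ} (h0 : 1 < Q0) (h1 : 1 < Q1) (u : ℕ → Bool) :
    piE Q0 Q1 u = (dv (u 0) + piE Q0 Q1 (shiftTail u 1)) / qb Q0 Q1 (u 0) := by
  conv_lhs => rw [← cs_shift u]
  exact piE_cs h0 h1 _ _

lemma piE_nonneg {Q0 Q1 : ℝ} (h0 : 1 < Q0) (h1 : 1 < Q1) (u : ℕ → Bool) : 0 ≤ piE Q0 Q1 u := by
  unfold piE
  apply tsum_nonneg
  intro k
  apply div_nonneg
  · split_ifs <;> simp
  · exact Finset.prod_nonneg (fun i _ => by linarith [qb_gt_one h0 h1 (u i)])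

lemma piE_le {Q0 Q1 : ℝ} (h0 : 1 < Q0) (h1 : 1 < Q1) (u : ℕ → Bool) :
    piE Q0 Q1 u ≤ (Q1 - 1)⁻¹ := by
  unfold piE
  have hK : 0 < (Q1 - 1)⁻¹ := inv_pos.2 (by linarith)
  apply (summable_term h0 h1 u).tsum_le_of_sum_range_le
  intro n
  induction n generalizing u with
  | zero => simpa using hK.le
  | succ n ih =>
    rw [Finset.sum_range_succ']
    have h2 := ih (shiftTail u 1)
    have h3 : ∑ k ∈ Finset.range n, (if u (k + 1) then (1 : ℝ) else 0) /
        ∏ j ∈ Finset.range (k + 1 + 1), qb Q0 Q1 (u j) =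
        (∑ k ∈ Finset.range n, (if shiftTail u 1 k then (1 : ℝ) else 0) /
        ∏ j ∈ Finset.range (k + 1), qb Q0 Q1 (shiftTail u 1 j)) / qb Q0 Q1 (u 0) := by
      rw [Finset.sum_div]
      apply Finset.sum_congr rfl
      intro k _
      rw [Finset.prod_range_succ' _ (k + 1), div_div]
      simp [shiftTail, add_comm]
    rw [h3]
    simp only [zero_add, Finset.prod_range_one]
    generalize (∑ k ∈ Finset.range n, (if shiftTail u 1 k then (1 : ℝ) else 0) /
        ∏ j ∈ Finset.range (k + 1), qb Q0 Q1 (shiftTail u 1 j)) = S at h2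
    rw [← add_div, div_le_iff₀ (by linarith [qb_gt_one h0 h1 (u 0)])]
    cases h : u 0
    · simp only [qb, Bool.false_eq_true, if_false, add_zero]
      nlinarith
    · simp only [qb, if_true]
      have : (Q1 - 1)⁻¹ * Q1 = (Q1 - 1)⁻¹ + 1 := by
        have : Q1 - 1 ≠ 0 := by linarith
        field_simp
        ring
      linarith

lemma piE_dist {Q0 Q1 : ℝ} (h0 : 1 < Q0) (h1 : 1 < Q1) (u v : ℕ → Bool) :
    |piE Q0 Q1 u - piE Q0 Q1 v| ≤ (Q1 - 1)⁻¹ := by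
  have := piE_nonneg h0 h1 u
  have := piE_nonneg h0 h1 v
  have := piE_le h0 h1 u
  have := piE_le h0 h1 v
  rw [abs_le]; constructor <;> linarith

lemma piE_continuous {Q0 Q1 : ℝ} (h0 : 1 < Q0) (h1 : 1 < Q1) : Continuous (piE Q0 Q1) := by
  unfold piE
  apply continuous_tsum _ (summable_geo (lt_min h0 h1))
    (fun k u => term_bound (lt_min h0 h1) (min_le_left _ _) (min_le_right _ _) u k)
  intro k
  apply Continuous.div
  · exact (continuous_of_discreteTopology (f := fun d : Bool => if d then (1 : ℝ) else 0)).comp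
      (continuous_apply k)
  · apply continuous_finsetProd
    intro j _
    exact (continuous_of_discreteTopology (f := fun d : Bool => qb Q0 Q1 d)).comp
      (continuous_apply j)
  · intro u
    exact (Finset.prod_pos (fun i _ => by linarith [qb_gt_one h0 h1 (u i)])).ne'

lemma rpow_gt_one {q s : ℝ} (hq : 1 < q) (hs : 0 < s) : 1 < q ^ s := Real.one_lt_rpow hq hs

lemma qb_rpow (q0 q1 s : ℝ) (d : Bool) : qb (q0 ^ s) (q1 ^ s) d = qb q0 q1 d ^ s := by
  unfold qb; split_ifs <;> rfl

lemma piE_continuousAt {q0 q1 : ℝ} (h0 : 1 < q0) (h1 : 1 < q1) (u : ℕ → Bool) {s : ℝ}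
    (hs : 0 < s) : ContinuousAt (fun t : ℝ => piE (q0 ^ t) (q1 ^ t) u) s := by
  have hs2 : 0 < s / 2 := by linarith
  have hm : 1 < min (q0 ^ (s / 2)) (q1 ^ (s / 2)) :=
    lt_min (rpow_gt_one h0 hs2) (rpow_gt_one h1 hs2)
  have : ContinuousOn (fun t : ℝ => piE (q0 ^ t) (q1 ^ t) u) (Set.Ici (s / 2)) := by
    unfold piE
    apply continuousOn_tsum _ (summable_geo hm)
    · intro k t ht
      apply term_bound hm
      · exact (min_le_left _ _).trans (Real.rpow_le_rpow_of_exponent_le h0.le ht)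
      · exact (min_le_right _ _).trans (Real.rpow_le_rpow_of_exponent_le h1.le ht)
    · intro k
      apply Continuous.continuousOn
      apply Continuous.div
      · exact continuous_const
      · apply continuous_finsetProd
        intro j _
        simp only [qb_rpow]
        exact Real.continuous_const_rpow (by linarith [qb_gt_one h0 h1 (u j)])
      · intro t
        apply (Finset.prod_pos (fun i _ => ?_)).ne'
        rw [qb_rpow]
        exact Real.rpow_pos_of_pos (by linarith [qb_gt_one h0 h1 (u i)]) _
  exact this.continuousAt (Ici_mem_nhds (by linarith))

/-! ### Words and lexicographic order -/

lemma lexLt_iff (u v : ℕ → Bool) : lexLt u v ↔ toLex u < toLex v := Iff.rfl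

lemma cs_lt_cs (d : Bool) (u v : ℕ → Bool) : toLex (cs d u) < toLex (cs d v) ↔ toLex u < toLex v := by
  rw [← lexLt_iff, ← lexLt_iff]
  constructor
  · rintro ⟨n, h1, h2⟩
    cases n with
    | zero => simp at h2
    | succ n => exact ⟨n, fun m hm => by simpa using h1 (m + 1) (by omega), by simpa using h2⟩
  · rintro ⟨n, h1, h2⟩
    refine ⟨n + 1, fun m hm => ?_, by simpa using h2⟩
    cases m with
    | zero => rfl
    | succ m => simpa using h1 m (by omega)

lemma cs_le_cs (d : Bool) (u v : ℕ → Bool) : toLex (cs d u) ≤ toLex (cs d v) ↔ toLex u ≤ toLex v := by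
  exact not_lt.symm.trans ((not_congr (cs_lt_cs d v u)).trans not_lt)

lemma lt_of_digit {u v : ℕ → Bool} (hu : u 0 = false) (hv : v 0 = true) : toLex u < toLex v :=
  (lexLt_iff u v).1 ⟨0, by simp, by simp [hu, hv]⟩

/-- Concatenate a word and a sequence. -/
def cat : List Bool → (ℕ → Bool) → (ℕ → Bool)
  | [], u => u
  | d :: w, u => cs d (cat w u)

lemma cat_le_cat (w : List Bool) (u v : ℕ → Bool) :
    toLex (cat w u) ≤ toLex (cat w v) ↔ toLex u ≤ toLex v := by
  induction w with
  | nil => rfl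
  | cons d w ih => simp only [cat, cs_le_cs, ih]

lemma cat_append (w w' : List Bool) (u : ℕ → Bool) : cat (w ++ w') u = cat w (cat w' u) := by
  induction w with
  | nil => rfl
  | cons d w ih => simp only [cat, List.cons_append, ih]

lemma cat_snoc (w : List Bool) (d : Bool) (u : ℕ → Bool) : cat (w ++ [d]) u = cat w (cs d u) :=
  cat_append w [d] u

/-- Product of bases along a word. -/
noncomputable def Qw (Q0 Q1 : ℝ) (w : List Bool) : ℝ := (w.map (qb Q0 Q1)).prod

@[simp] lemma Qw_nil (Q0 Q1 : ℝ) : Qw Q0 Q1 [] = 1 := by simp [Qw]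
lemma Qw_cons (Q0 Q1 : ℝ) (d : Bool) (w : List Bool) :
    Qw Q0 Q1 (d :: w) = qb Q0 Q1 d * Qw Q0 Q1 w := by simp [Qw]
lemma Qw_append (Q0 Q1 : ℝ) (w w' : List Bool) :
    Qw Q0 Q1 (w ++ w') = Qw Q0 Q1 w * Qw Q0 Q1 w' := by simp [Qw]
lemma Qw_snoc (Q0 Q1 : ℝ) (w : List Bool) (d : Bool) :
    Qw Q0 Q1 (w ++ [d]) = Qw Q0 Q1 w * qb Q0 Q1 d := by simp [Qw]

lemma Qw_ge {m Q0 Q1 : ℝ} (hm : 1 < m) (h0 : m ≤ Q0) (h1 : m ≤ Q1) (w : List Bool) :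
    m ^ w.length ≤ Qw Q0 Q1 w := by
  induction w with
  | nil => simp
  | cons d w ih =>
    rw [Qw_cons, List.length_cons, pow_succ']
    have := qb_ge h0 h1 d
    have : 0 ≤ qb Q0 Q1 d := by linarith
    gcongr

lemma Qw_ge_one {Q0 Q1 : ℝ} (h0 : 1 < Q0) (h1 : 1 < Q1) (w : List Bool) : 1 ≤ Qw Q0 Q1 w :=
  (one_le_pow₀ (lt_min h0 h1).le).trans
    (Qw_ge (lt_min h0 h1) (min_le_left _ _) (min_le_right _ _) w)

lemma Qw_pos {Q0 Q1 : ℝ} (h0 : 1 < Q0) (h1 : 1 < Q1) (w : List Bool) : 0 < Qw Q0 Q1 w :=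
  zero_lt_one.trans_le (Qw_ge_one h0 h1 w)

lemma Qw_rpow {q0 q1 : ℝ} (h0 : 1 < q0) (h1 : 1 < q1) (s : ℝ) (w : List Bool) :
    Qw (q0 ^ s) (q1 ^ s) w = Qw q0 q1 w ^ s := by
  induction w with
  | nil => simp
  | cons d w ih =>
    rw [Qw_cons, Qw_cons, ih, qb_rpow, Real.mul_rpow]
    · linarith [qb_gt_one h0 h1 d]
    · exact (Qw_pos h0 h1 w).le

lemma piE_cat_sub {Q0 Q1 : ℝ} (h0 : 1 < Q0) (h1 : 1 < Q1) (w : List Bool) (u v : ℕ → Bool) :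
    piE Q0 Q1 (cat w u) - piE Q0 Q1 (cat w v) = (piE Q0 Q1 u - piE Q0 Q1 v) / Qw Q0 Q1 w := by
  induction w with
  | nil => simp [cat]
  | cons d w ih =>
    simp only [cat, piE_cs h0 h1, Qw_cons]
    rw [← sub_div, add_sub_add_left_eq_sub, ih, div_div, mul_comm]

/-- Two different sequences split after a common prefix. -/
lemma exists_split {u v : ℕ → Bool} (h : toLex u < toLex v) :
    ∃ w u' v', u = cat w u' ∧ v = cat w v' ∧ u' 0 = false ∧ v' 0 = true := by
  obtain ⟨n, h1, h2⟩ := (lexLt_iff u v).2 h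
  clear h
  induction n generalizing u v with
  | zero =>
    refine ⟨[], u, v, rfl, rfl, ?_, ?_⟩
    · revert h2; cases u 0 <;> cases v 0 <;> simp
    · revert h2; cases u 0 <;> cases v 0 <;> simp
  | succ n ih =>
    obtain ⟨w, u', v', e1, e2, e3, e4⟩ := @ih (shiftTail u 1) (shiftTail v 1)
      (fun m hm => by simpa [shiftTail, add_comm] using h1 (m + 1) (by omega))
      (by simpa [shiftTail, add_comm] using h2)
    refine ⟨u 0 :: w, u', v', ?_, ?_, e3, e4⟩
    · rw [cat, ← e1, cs_shift]
    · rw [cat, ← e2, h1 0 (by omega), cs_shift]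

lemma exists_pref (u : ℕ → Bool) (n : ℕ) : ∃ w u', u = cat w u' ∧ w.length = n := by
  induction n generalizing u with
  | zero => exact ⟨[], u, rfl, rfl⟩
  | succ n ih =>
    obtain ⟨w, u', e, hl⟩ := ih (shiftTail u 1)
    exact ⟨u 0 :: w, u', by rw [cat, ← e, cs_shift], by simp [hl]⟩

/-! ### The set `Omega` -/

section Om
variable {a b : ℕ → Bool}

lemma Om_le (hb : b 0 = true) {u : ℕ → Bool} (hu : u ∈ Omega a b)
    (h : u 0 = false) : toLex u ≤ toLex a := by
  have := hu 0
  rw [shift_zero] at this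
  by_contra hc
  exact this ⟨not_le.1 hc, lt_of_digit h hb⟩

lemma Om_ge (ha : a 0 = false) {u : ℕ → Bool} (hu : u ∈ Omega a b)
    (h : u 0 = true) : toLex b ≤ toLex u := by
  have := hu 0
  rw [shift_zero] at this
  by_contra hc
  exact this ⟨lt_of_digit ha h, not_le.1 hc⟩

lemma Om_of_tails {u : ℕ → Bool}
    (h : ∀ n, (u n = false → toLex (shiftTail u n) ≤ toLex a) ∧
      (u n = true → toLex b ≤ toLex (shiftTail u n))) : u ∈ Omega a b := by
  rintro n ⟨h1, h2⟩
  cases hd : u n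
  · exact absurd h1 (not_lt.2 ((h n).1 hd))
  · exact absurd h2 (not_lt.2 ((h n).2 hd))

lemma Om_shift {u : ℕ → Bool} (hu : u ∈ Omega a b) (m : ℕ) : shiftTail u m ∈ Omega a b := by
  intro n
  rw [shift_shift]
  exact hu _

lemma Om_of_cs {d : Bool} {u : ℕ → Bool} (hu : cs d u ∈ Omega a b) : u ∈ Omega a b := by
  have := Om_shift hu 1
  rwa [shift_cs, shift_zero] at this

lemma Om_cs {d : Bool} {u : ℕ → Bool} (hu : u ∈ Omega a b)
    (h1 : d = false → toLex (cs d u) ≤ toLex a) (h2 : d = true → toLex b ≤ toLex (cs d u)) :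
    cs d u ∈ Omega a b := by
  intro n
  cases n with
  | zero =>
    rw [shift_zero]
    rintro ⟨h3, h4⟩
    cases d
    · exact absurd h3 (not_lt.2 (h1 rfl))
    · exact absurd h4 (not_lt.2 (h2 rfl))
  | succ n =>
    rw [shift_cs]
    exact hu n

lemma Om_of_cat {w : List Bool} {u : ℕ → Bool} (hu : cat w u ∈ Omega a b) : u ∈ Omega a b := by
  induction w with
  | nil => exact hu
  | cons d w ih => exact ih (Om_of_cs hu)

lemma Om_special (hW : memW a b) {w : List Bool} {x y : ℕ → Bool} (hx : cat w x ∈ Omega a b)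
    (hy : cat w y ∈ Omega a b) (hx0 : x 0 = false) (hy0 : y 0 = true) :
    cat w a ∈ Omega a b ∧ cat w b ∈ Omega a b := by
  obtain ⟨ha, hb, haO, hbO⟩ := hW
  induction w with
  | nil => exact ⟨haO, hbO⟩
  | cons d w ih =>
    obtain ⟨i1, i2⟩ := ih (Om_of_cs hx) (Om_of_cs hy)
    have xa : toLex x ≤ toLex a := Om_le hb (Om_of_cat hx) hx0
    have yb : toLex b ≤ toLex y := Om_ge ha (Om_of_cat hy) hy0
    have ay : toLex a ≤ toLex y := (lt_of_digit ha hy0).le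
    have xb : toLex x ≤ toLex b := (lt_of_digit hx0 hb).le
    refine ⟨Om_cs i1 ?_ ?_, Om_cs i2 ?_ ?_⟩ <;> rintro rfl
    · exact le_trans ((cat_le_cat (false :: w) a y).2 ay) (Om_le hb hy rfl)
    · exact le_trans (Om_ge ha hx rfl) ((cat_le_cat (true :: w) x a).2 xa)
    · exact le_trans ((cat_le_cat (false :: w) b y).2 yb) (Om_le hb hy rfl)
    · exact le_trans (Om_ge ha hx rfl) ((cat_le_cat (true :: w) x b).2 xb)

lemma all_false_le (u : ℕ → Bool) : toLex (fun _ : ℕ => false) ≤ toLex u := by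
  rw [← not_lt]
  intro h
  obtain ⟨n, _, h2⟩ := (lexLt_iff u _).2 h
  revert h2; cases u n <;> simp

lemma le_all_true (u : ℕ → Bool) : toLex u ≤ toLex (fun _ : ℕ => true) := by
  rw [← not_lt]
  intro h
  obtain ⟨n, _, h2⟩ := (lexLt_iff _ u).2 h
  revert h2; cases u n <;> simp

lemma false_mem : (fun _ : ℕ => false) ∈ Omega a b :=
  Om_of_tails (fun _ => ⟨fun _ => all_false_le _, fun h => by simp at h⟩)

lemma true_mem : (fun _ : ℕ => true) ∈ Omega a b :=
  Om_of_tails (fun _ => ⟨fun h => by simp at h, fun _ => le_all_true _⟩)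

lemma isOpen_lexLt (c : ℕ → Bool) : IsOpen {v : ℕ → Bool | lexLt c v} ∧ IsOpen {v | lexLt v c} := by
  constructor
  · have : {v : ℕ → Bool | lexLt c v} =
        ⋃ n, ((⋂ m ∈ Finset.range n, {v | c m = v m}) ∩ {v | c n < v n}) := by
      ext v; simp [lexLt]
    rw [this]
    refine isOpen_iUnion fun n => IsOpen.inter (isOpen_biInter_finset fun m _ => ?_) ?_
    · exact (isOpen_discrete {d : Bool | c m = d}).preimage
        (continuous_apply (A := fun _ : ℕ => Bool) m)
    · exact (isOpen_discrete {d : Bool | c n < d}).preimage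
        (continuous_apply (A := fun _ : ℕ => Bool) n)
  · have : {v : ℕ → Bool | lexLt v c} =
        ⋃ n, ((⋂ m ∈ Finset.range n, {v | v m = c m}) ∩ {v | v n < c n}) := by
      ext v; simp [lexLt]
    rw [this]
    refine isOpen_iUnion fun n => IsOpen.inter (isOpen_biInter_finset fun m _ => ?_) ?_
    · exact (isOpen_discrete {d : Bool | d = c m}).preimage
        (continuous_apply (A := fun _ : ℕ => Bool) m)
    · exact (isOpen_discrete {d : Bool | d < c n}).preimage
        (continuous_apply (A := fun _ : ℕ => Bool) n)

lemma Om_closed : IsClosed (Omega a b) := by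
  have : Omega a b = ⋂ n, {i | lexLt a (shiftTail i n) ∧ lexLt (shiftTail i n) b}ᶜ := by
    ext i; simp [Omega]
  rw [this]
  refine isClosed_iInter fun n => IsOpen.isClosed_compl ?_
  have hc : Continuous (fun i : ℕ → Bool => shiftTail i n) :=
    continuous_pi fun k => continuous_apply (n + k)
  exact ((isOpen_lexLt a).1.inter (isOpen_lexLt b).2).preimage hc

end Om

/-! ### The language of `Omega` and the partition sums -/

section Lang
variable (a b : ℕ → Bool)

/-- `w` is a prefix of an element of `Omega a b`. -/
def Lng (w : List Bool) : Prop := ∃ u, cat w u ∈ Omega a b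

/-- Both extensions of `w` are in the language. -/
def Spec (w : List Bool) : Prop := Lng a b (w ++ [false]) ∧ Lng a b (w ++ [true])

open Classical in
/-- Words of length `n` of the language. -/
noncomputable def Lw : ℕ → Finset (List Bool)
  | 0 => {[]}
  | n + 1 => ((Lw n).image (· ++ [false]) ∪ (Lw n).image (· ++ [true])).filter (Lng a b)

variable {a b}

lemma Lng_nil : Lng a b [] := ⟨_, false_mem⟩

lemma Lng_of_append {w w' : List Bool} (h : Lng a b (w ++ w')) : Lng a b w := by
  obtain ⟨u, hu⟩ := h
  exact ⟨cat w' u, by rwa [cat_append] at hu⟩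

lemma Lng_of_append' {w w' : List Bool} (h : Lng a b (w ++ w')) : Lng a b w' := by
  obtain ⟨u, hu⟩ := h
  rw [cat_append] at hu
  exact ⟨u, Om_of_cat hu⟩

lemma mem_Lw {n : ℕ} {w : List Bool} : w ∈ Lw a b n ↔ w.length = n ∧ Lng a b w := by
  induction n generalizing w with
  | zero =>
    simp only [Lw, Finset.mem_singleton, List.length_eq_zero_iff]
    constructor
    · rintro rfl; exact ⟨rfl, Lng_nil⟩
    · exact fun h => h.1
  | succ n ih =>
    simp only [Lw, Finset.mem_filter, Finset.mem_union, Finset.mem_image, ih]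
    constructor
    · rintro ⟨⟨w', ⟨h1, h2⟩, rfl⟩ | ⟨w', ⟨h1, h2⟩, rfl⟩, h3⟩ <;> exact ⟨by simp [h1], h3⟩
    · rintro ⟨h1, h2⟩
      refine ⟨?_, h2⟩
      rcases List.eq_nil_or_concat w with rfl | ⟨w', d, rfl⟩
      · simp at h1
      · have hl : w'.length = n := by simpa using h1
        simp only [List.concat_eq_append] at h2 ⊢
        have := Lng_of_append h2
        cases d
        · exact Or.inl ⟨w', ⟨hl, this⟩, rfl⟩
        · exact Or.inr ⟨w', ⟨hl, this⟩, rfl⟩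

open Classical in
lemma sum_Lw_succ (n : ℕ) (f : List Bool → ℝ) :
    ∑ w ∈ Lw a b (n + 1), f w = ∑ w ∈ Lw a b n,
      ((if Lng a b (w ++ [false]) then f (w ++ [false]) else 0) +
       (if Lng a b (w ++ [true]) then f (w ++ [true]) else 0)) := by
  rw [Lw, Finset.sum_filter, Finset.sum_union, Finset.sum_image, Finset.sum_image,
    Finset.sum_add_distrib]
  · intro x _ y _ h; simpa using h
  · intro x _ y _ h; simpa using h
  · rw [Finset.disjoint_left]
    intro w h1 h2
    simp only [Finset.mem_image] at h1 h2
    obtain ⟨x, _, rfl⟩ := h1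
    obtain ⟨y, _, h⟩ := h2
    have := List.append_inj_right' h rfl
    simp at this

variable (a b)

/-- Partition sum. -/
noncomputable def Z (Q0 Q1 : ℝ) (n : ℕ) : ℝ := ∑ w ∈ Lw a b n, (Qw Q0 Q1 w)⁻¹

open Classical in
/-- Partition sum over right special words. -/
noncomputable def rs (Q0 Q1 : ℝ) (n : ℕ) : ℝ :=
  ∑ w ∈ Lw a b n, if Spec a b w then (Qw Q0 Q1 w)⁻¹ else 0

/-- Cumulative version of `rs`. -/
noncomputable def Rs (Q0 Q1 : ℝ) (n : ℕ) : ℝ := ∑ k ∈ Finset.range n, rs a b Q0 Q1 k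

variable {a b}

lemma Z_nonneg {Q0 Q1 : ℝ} (h0 : 1 < Q0) (h1 : 1 < Q1) (n : ℕ) : 0 ≤ Z a b Q0 Q1 n :=
  Finset.sum_nonneg fun w _ => (inv_pos.2 (Qw_pos h0 h1 w)).le

lemma rs_nonneg {Q0 Q1 : ℝ} (h0 : 1 < Q0) (h1 : 1 < Q1) (n : ℕ) : 0 ≤ rs a b Q0 Q1 n :=
  Finset.sum_nonneg fun w _ => by
    split_ifs
    · exact (inv_pos.2 (Qw_pos h0 h1 w)).le
    · exact le_rfl

lemma Rs_mono {Q0 Q1 : ℝ} (h0 : 1 < Q0) (h1 : 1 < Q1) : Monotone (Rs a b Q0 Q1) := by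
  apply monotone_nat_of_le_succ
  intro n
  rw [Rs, Rs, Finset.sum_range_succ]
  linarith [rs_nonneg (a := a) (b := b) h0 h1 n]

lemma Z_zero (Q0 Q1 : ℝ) : Z a b Q0 Q1 0 = 1 := by simp [Z, Lw]

lemma Z_add_le {Q0 Q1 : ℝ} (h0 : 1 < Q0) (h1 : 1 < Q1) (m n : ℕ) :
    Z a b Q0 Q1 (m + n) ≤ Z a b Q0 Q1 m * Z a b Q0 Q1 n := by
  classical
  have hinj : Set.InjOn (fun p : List Bool × List Bool => p.1 ++ p.2)
      (Lw a b m ×ˢ Lw a b n : Finset _) := by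
    rintro ⟨x, y⟩ h ⟨x', y'⟩ h' e
    simp only [Finset.coe_product, Set.mem_prod, Finset.mem_coe, mem_Lw] at h h'
    have := List.append_inj e (by rw [h.1.1, h'.1.1])
    exact Prod.ext this.1 this.2
  have hsub : Lw a b (m + n) ⊆
      (Lw a b m ×ˢ Lw a b n).image (fun p : List Bool × List Bool => p.1 ++ p.2) := by
    intro w hw
    rw [mem_Lw] at hw
    have e : w.take m ++ w.drop m = w := List.take_append_drop m w
    rw [Finset.mem_image]
    refine ⟨(w.take m, w.drop m), ?_, e⟩
    have h2 := hw.2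
    rw [← e] at h2
    simp only [Finset.mem_product, mem_Lw]
    exact ⟨⟨by simp [hw.1], Lng_of_append h2⟩, ⟨by simp [hw.1], Lng_of_append' h2⟩⟩
  unfold Z
  rw [Finset.sum_mul_sum, ← Finset.sum_product']
  calc _ ≤ _ := Finset.sum_le_sum_of_subset_of_nonneg hsub
        (fun w _ _ => (inv_pos.2 (Qw_pos h0 h1 w)).le)
    _ = _ := by
      rw [Finset.sum_image hinj]
      apply Finset.sum_congr rfl
      rintro ⟨x, y⟩ _
      simp only [Qw_append, mul_inv]

lemma Z_mul_le {Q0 Q1 : ℝ} (h0 : 1 < Q0) (h1 : 1 < Q1) (n k : ℕ) :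
    Z a b Q0 Q1 (k * n) ≤ Z a b Q0 Q1 n ^ k := by
  induction k with
  | zero => simp [Z_zero]
  | succ k ih =>
    rw [Nat.succ_mul, pow_succ]
    exact (Z_add_le h0 h1 _ _).trans (mul_le_mul_of_nonneg_right ih (Z_nonneg h0 h1 n))

lemma qb_inv_le {Q0 Q1 : ℝ} (h0 : 1 < Q0) (h1 : 1 < Q1) (d : Bool) :
    (qb Q0 Q1 d)⁻¹ ≤ (min Q0 Q1)⁻¹ :=
  inv_anti₀ (by linarith [lt_min h0 h1]) (qb_ge (min_le_left _ _) (min_le_right _ _) d)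

lemma Z_succ_le {Q0 Q1 : ℝ} (h0 : 1 < Q0) (h1 : 1 < Q1) (n : ℕ) :
    Z a b Q0 Q1 (n + 1) ≤ (min Q0 Q1)⁻¹ * (Z a b Q0 Q1 n + rs a b Q0 Q1 n) := by
  classical
  unfold Z rs
  rw [sum_Lw_succ, ← Finset.sum_add_distrib, Finset.mul_sum]
  apply Finset.sum_le_sum
  intro w _
  simp only [Qw_snoc, mul_inv]
  have hp : 0 < (Qw Q0 Q1 w)⁻¹ := inv_pos.2 (Qw_pos h0 h1 w)
  have e0 := mul_le_mul_of_nonneg_left (qb_inv_le h0 h1 false) hp.le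
  have e1 := mul_le_mul_of_nonneg_left (qb_inv_le h0 h1 true) hp.le
  have hm : 0 < (min Q0 Q1)⁻¹ := inv_pos.2 (by linarith [lt_min h0 h1])
  have := mul_pos hm hp
  unfold Spec
  by_cases c0 : Lng a b (w ++ [false]) <;> by_cases c1 : Lng a b (w ++ [true]) <;>
    simp only [c0, c1, if_true, if_false, and_self, and_true, and_false] <;> nlinarith

lemma Z_sum_le {Q0 Q1 : ℝ} (h0 : 1 < Q0) (h1 : 1 < Q1) (n : ℕ) :
    (1 - (min Q0 Q1)⁻¹) * ∑ k ∈ Finset.range (n + 1), Z a b Q0 Q1 k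
      ≤ 1 + (min Q0 Q1)⁻¹ * Rs a b Q0 Q1 n := by
  have hm : 0 < (min Q0 Q1)⁻¹ := inv_pos.2 (by linarith [lt_min h0 h1])
  have key : ∑ k ∈ Finset.range (n + 1), Z a b Q0 Q1 k ≤
      1 + (min Q0 Q1)⁻¹ * (∑ k ∈ Finset.range n, Z a b Q0 Q1 k + Rs a b Q0 Q1 n) := by
    rw [Finset.sum_range_succ', Z_zero, Rs, ← Finset.sum_add_distrib, Finset.mul_sum, add_comm]
    gcongr
    exact Z_succ_le h0 h1 _
  have h3 : ∑ k ∈ Finset.range n, Z a b Q0 Q1 k ≤ ∑ k ∈ Finset.range (n + 1), Z a b Q0 Q1 k := by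
    rw [Finset.sum_range_succ]; linarith [Z_nonneg (a := a) (b := b) h0 h1 n]
  nlinarith [mul_le_mul_of_nonneg_left h3 hm.le]

/-- If all partition sums are at least one, the special sums are unbounded. -/
lemma Rs_unbounded {Q0 Q1 : ℝ} (h0 : 1 < Q0) (h1 : 1 < Q1) (hZ : ∀ n, 1 ≤ Z a b Q0 Q1 n) (C : ℝ) :
    ∃ n, C < Rs a b Q0 Q1 n := by
  have hm : 0 < (min Q0 Q1)⁻¹ := inv_pos.2 (by linarith [lt_min h0 h1])
  have hm1 : (min Q0 Q1)⁻¹ < 1 := inv_lt_one_of_one_lt₀ (lt_min h0 h1)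
  obtain ⟨n, hn⟩ := exists_nat_gt ((1 + (min Q0 Q1)⁻¹ * C) / (1 - (min Q0 Q1)⁻¹))
  refine ⟨n, ?_⟩
  rw [div_lt_iff₀ (by linarith)] at hn
  have h2 := Z_sum_le (a := a) (b := b) h0 h1 n
  have h3 : ((n : ℝ) + 1) ≤ ∑ k ∈ Finset.range (n + 1), Z a b Q0 Q1 k := by
    have := Finset.sum_le_sum (s := Finset.range (n + 1)) (fun k _ => hZ k)
    simpa using this
  by_contra hc
  push Not at hc
  have h4 := mul_le_mul_of_nonneg_left hc hm.le
  have h5 := mul_le_mul_of_nonneg_left h3 (sub_pos.2 hm1).le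
  nlinarith

/-! ### Extremal tails -/

variable (a b)

/-- `x` and `y` are the least and the greatest tail after `w`. -/
def Extr (w : List Bool) (x y : ℕ → Bool) : Prop :=
  cat w x ∈ Omega a b ∧ cat w y ∈ Omega a b ∧
    ∀ u, cat w u ∈ Omega a b → toLex x ≤ toLex u ∧ toLex u ≤ toLex y

variable {a b}

lemma Extr_unique {w : List Bool} {x y x' y' : ℕ → Bool} (h : Extr a b w x y)
    (h' : Extr a b w x' y') : x = x' ∧ y = y' :=
  ⟨toLex.injective (le_antisymm (h.2.2 _ h'.1).1 (h'.2.2 _ h.1).1),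
   toLex.injective (le_antisymm (h'.2.2 _ h.2.1).2 (h.2.2 _ h'.2.1).2)⟩

lemma Extr_nil : Extr a b [] (fun _ => false) (fun _ => true) :=
  ⟨false_mem, true_mem, fun u _ => ⟨all_false_le u, le_all_true u⟩⟩

lemma exists_cs {u : ℕ → Bool} {d : Bool} (h : u 0 = d) : ∃ u', u = cs d u' :=
  ⟨shiftTail u 1, by rw [← h, cs_shift]⟩

lemma digit_of_not {w : List Bool} {d : Bool} (hn : ¬ Lng a b (w ++ [d])) {u : ℕ → Bool}
    (hu : cat w u ∈ Omega a b) : u 0 = !d := by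
  by_contra hc
  have : u 0 = d := by revert hc; cases u 0 <;> cases d <;> simp
  obtain ⟨u', rfl⟩ := exists_cs this
  exact hn ⟨u', by rwa [cat_snoc]⟩

lemma Extr_single {w : List Bool} {x y : ℕ → Bool} (h : Extr a b w x y) {d : Bool}
    (hn : ¬ Lng a b (w ++ [d])) :
    ∃ x' y', x = cs (!d) x' ∧ y = cs (!d) y' ∧ Extr a b (w ++ [!d]) x' y' := by
  obtain ⟨x', rfl⟩ := exists_cs (digit_of_not hn h.1)
  obtain ⟨y', rfl⟩ := exists_cs (digit_of_not hn h.2.1)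
  refine ⟨x', y', rfl, rfl, ?_, ?_, ?_⟩
  · rw [cat_snoc]; exact h.1
  · rw [cat_snoc]; exact h.2.1
  · intro u hu
    rw [cat_snoc] at hu
    have := h.2.2 _ hu
    rwa [cs_le_cs, cs_le_cs] at this

lemma digit_mono {u v : ℕ → Bool} (h : toLex u ≤ toLex v) : u 0 = true → v 0 = true := by
  intro hu
  by_contra hc
  have : v 0 = false := by simpa using hc
  exact absurd (lt_of_digit this hu) (not_lt.2 h)

lemma Extr_spec (hW : memW a b) {w : List Bool} {x y : ℕ → Bool} (h : Extr a b w x y)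
    (hs : Spec a b w) :
    ∃ x' y' a' b', x = cs false x' ∧ y = cs true y' ∧ a = cs false a' ∧ b = cs true b' ∧
      Extr a b (w ++ [false]) x' a' ∧ Extr a b (w ++ [true]) b' y' := by
  obtain ⟨⟨u, hu⟩, ⟨v, hv⟩⟩ := hs
  rw [cat_snoc] at hu hv
  have hx : x 0 = false := by
    by_contra hc
    have := digit_mono (h.2.2 _ hu).1 (by simpa using hc)
    simp at this
  have hy : y 0 = true := digit_mono (h.2.2 _ hv).2 rfl
  obtain ⟨wa, wb⟩ := Om_special hW hu hv rfl rfl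
  obtain ⟨ha, hb, haO, hbO⟩ := hW
  obtain ⟨x', hx'⟩ := exists_cs hx
  obtain ⟨y', hy'⟩ := exists_cs hy
  obtain ⟨a', ha'⟩ := exists_cs ha
  obtain ⟨b', hb'⟩ := exists_cs hb
  refine ⟨x', y', a', b', hx', hy', ha', hb', ⟨?_, ?_, ?_⟩, ⟨?_, ?_, ?_⟩⟩
  · rw [cat_snoc, ← hx']; exact h.1
  · rw [cat_snoc, ← ha']; exact wa
  · intro t ht
    rw [cat_snoc] at ht
    rw [← cs_le_cs false, ← cs_le_cs false t, ← hx', ← ha']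
    exact ⟨(h.2.2 _ ht).1, Om_le hb (Om_of_cat ht) rfl⟩
  · rw [cat_snoc, ← hb']; exact wb
  · rw [cat_snoc, ← hy']; exact h.2.1
  · intro t ht
    rw [cat_snoc] at ht
    rw [← cs_le_cs true, ← cs_le_cs true t, ← hy', ← hb']
    exact ⟨Om_ge ha (Om_of_cat ht) rfl, (h.2.2 _ ht).2⟩

lemma Extr_exists (hW : memW a b) (w : List Bool) (hw : Lng a b w) : ∃ x y, Extr a b w x y := by
  induction w using List.reverseRecOn with
  | nil => exact ⟨_, _, Extr_nil⟩
  | append_singleton w d ih =>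
    obtain ⟨x, y, h⟩ := ih (Lng_of_append hw)
    by_cases hn : Lng a b (w ++ [!d])
    · have hs : Spec a b w := by
        cases d
        · exact ⟨hw, hn⟩
        · exact ⟨hn, hw⟩
      obtain ⟨x', y', a', b', _, _, _, _, e1, e2⟩ := Extr_spec hW h hs
      cases d
      · exact ⟨_, _, e1⟩
      · exact ⟨_, _, e2⟩
    · obtain ⟨x', y', _, _, e⟩ := Extr_single h hn
      rw [Bool.not_not] at e
      exact ⟨_, _, e⟩

variable (a b)

open Classical in
/-- Oscillation of `piE` between the extremal tails after `w`. -/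
noncomputable def nu (Q0 Q1 : ℝ) (w : List Bool) : ℝ :=
  if h : ∃ p : (ℕ → Bool) × (ℕ → Bool), Extr a b w p.1 p.2 then
    piE Q0 Q1 h.choose.2 - piE Q0 Q1 h.choose.1 else 0

variable {a b}

lemma nu_eq (Q0 Q1 : ℝ) {w : List Bool} {x y : ℕ → Bool} (h : Extr a b w x y) :
    nu a b Q0 Q1 w = piE Q0 Q1 y - piE Q0 Q1 x := by
  have hex : ∃ p : (ℕ → Bool) × (ℕ → Bool), Extr a b w p.1 p.2 := ⟨(x, y), h⟩
  rw [nu, dif_pos hex]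
  obtain ⟨e1, e2⟩ := Extr_unique hex.choose_spec h
  rw [e1, e2]

lemma nu_abs {Q0 Q1 : ℝ} (h0 : 1 < Q0) (h1 : 1 < Q1) (w : List Bool) :
    |nu a b Q0 Q1 w| ≤ (Q1 - 1)⁻¹ := by
  unfold nu
  split_ifs
  · exact piE_dist h0 h1 _ _
  · simp only [abs_zero]; exact (inv_pos.2 (by linarith)).le

/-- The basic identity, one step. -/
lemma nu_step (hW : memW a b) {Q0 Q1 : ℝ} (h0 : 1 < Q0) (h1 : 1 < Q1) (n : ℕ) :
    ∑ w ∈ Lw a b (n + 1), nu a b Q0 Q1 w * (Qw Q0 Q1 w)⁻¹ =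
    ∑ w ∈ Lw a b n, nu a b Q0 Q1 w * (Qw Q0 Q1 w)⁻¹
      - (piE Q0 Q1 b - piE Q0 Q1 a) * rs a b Q0 Q1 n := by
  classical
  unfold rs
  rw [sum_Lw_succ, Finset.mul_sum, ← Finset.sum_sub_distrib]
  apply Finset.sum_congr rfl
  intro w hw
  rw [mem_Lw] at hw
  have hQ := (Qw_pos h0 h1 w).ne'
  have q0 := (zero_lt_one.trans (qb_gt_one h0 h1 false)).ne'
  have q1 := (zero_lt_one.trans (qb_gt_one h0 h1 true)).ne'
  obtain ⟨x, y, h⟩ := Extr_exists hW w hw.2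
  simp only [Qw_snoc]
  by_cases hs : Spec a b w
  · rw [if_pos hs, if_pos hs.1, if_pos hs.2]
    obtain ⟨x', y', a', b', hx', hy', ha', hb', e1, e2⟩ := Extr_spec hW h hs
    rw [nu_eq Q0 Q1 h, nu_eq Q0 Q1 e1, nu_eq Q0 Q1 e2, hx', hy']
    conv_rhs => rw [ha', hb']
    simp only [piE_cs h0 h1]
    field_simp
    ring
  · rw [if_neg hs]
    by_cases c0 : Lng a b (w ++ [false])
    · have c1 : ¬ Lng a b (w ++ [true]) := fun c1 => hs ⟨c0, c1⟩
      rw [if_pos c0, if_neg c1]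
      obtain ⟨x', y', rfl, rfl, e⟩ := Extr_single h c1
      rw [Bool.not_true] at h e
      rw [nu_eq Q0 Q1 h, nu_eq Q0 Q1 e]
      simp only [piE_cs h0 h1]
      field_simp
      ring
    · rw [if_neg c0]
      obtain ⟨x', y', rfl, rfl, e⟩ := Extr_single h c0
      rw [Bool.not_false] at h e
      rw [if_pos ⟨x', e.1⟩]
      rw [nu_eq Q0 Q1 h, nu_eq Q0 Q1 e]
      simp only [piE_cs h0 h1]
      field_simp
      ring

lemma cs_const (d : Bool) : cs d (fun _ => d) = fun _ => d := by
  funext n; cases n <;> rfl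

lemma piE_true {Q0 Q1 : ℝ} (h0 : 1 < Q0) (h1 : 1 < Q1) :
    piE Q0 Q1 (fun _ => true) = (Q1 - 1)⁻¹ := by
  have h := piE_cs h0 h1 true (fun _ => true)
  rw [cs_const] at h
  have : Q1 - 1 ≠ 0 := by linarith
  simp only [dv, qb, if_true] at h
  rw [eq_div_iff (by linarith)] at h
  apply eq_inv_of_mul_eq_one_left
  linarith

lemma piE_false (Q0 Q1 : ℝ) : piE Q0 Q1 (fun _ => false) = 0 := by
  simp [piE]

/-- The basic identity. -/
lemma nu_ident (hW : memW a b) {Q0 Q1 : ℝ} (h0 : 1 < Q0) (h1 : 1 < Q1) (n : ℕ) :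
    ∑ w ∈ Lw a b n, nu a b Q0 Q1 w * (Qw Q0 Q1 w)⁻¹
      + (piE Q0 Q1 b - piE Q0 Q1 a) * Rs a b Q0 Q1 n = (Q1 - 1)⁻¹ := by
  induction n with
  | zero =>
    simp [Rs, Lw, nu_eq Q0 Q1 Extr_nil, piE_true h0 h1, piE_false]
  | succ n ih =>
    rw [nu_step hW h0 h1, Rs, Finset.sum_range_succ, ← Rs]
    linarith

lemma nu_sum_abs {Q0 Q1 : ℝ} (h0 : 1 < Q0) (h1 : 1 < Q1) (n : ℕ) :
    |∑ w ∈ Lw a b n, nu a b Q0 Q1 w * (Qw Q0 Q1 w)⁻¹| ≤ (Q1 - 1)⁻¹ * Z a b Q0 Q1 n := by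
  unfold Z
  rw [Finset.mul_sum]
  refine (Finset.abs_sum_le_sum_abs _ _).trans (Finset.sum_le_sum fun w _ => ?_)
  have := inv_pos.2 (Qw_pos h0 h1 w)
  rw [abs_mul, abs_of_pos this]
  exact mul_le_mul_of_nonneg_right (nu_abs h0 h1 w) this.le

end Lang

/-! ### Surjectivity when the two branches overlap -/

section Surj
variable {a b : ℕ → Bool}

lemma piE_shift {Q0 Q1 : ℝ} (h0 : 1 < Q0) (h1 : 1 < Q1) (d : ℕ → Bool) (n : ℕ) :
    piE Q0 Q1 (shiftTail d (n + 1)) =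
      qb Q0 Q1 (d n) * piE Q0 Q1 (shiftTail d n) - dv (d n) := by
  have h := piE_eq h0 h1 (shiftTail d n)
  rw [shift_shift] at h
  have e : shiftTail d n 0 = d n := by simp [shiftTail]
  rw [e, eq_div_iff (by linarith [qb_gt_one h0 h1 (d n)])] at h
  linarith

lemma bounded_orbit {Q0 Q1 : ℝ} (h0 : 1 < Q0) (h1 : 1 < Q1) (d : ℕ → Bool) (y : ℕ → ℝ) (C : ℝ)
    (hy : ∀ n, y (n + 1) = qb Q0 Q1 (d n) * y n - dv (d n)) (hC : ∀ n, |y n| ≤ C) :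
    piE Q0 Q1 d = y 0 := by
  have hm := lt_min h0 h1
  have key : ∀ n, |y 0 - piE Q0 Q1 d| * (min Q0 Q1) ^ n ≤ |y n - piE Q0 Q1 (shiftTail d n)| := by
    intro n
    induction n with
    | zero => simp
    | succ n ih =>
      rw [hy, piE_shift h0 h1]
      have e : qb Q0 Q1 (d n) * y n - dv (d n) -
          (qb Q0 Q1 (d n) * piE Q0 Q1 (shiftTail d n) - dv (d n)) =
          qb Q0 Q1 (d n) * (y n - piE Q0 Q1 (shiftTail d n)) := by ring
      have hq := qb_ge (min_le_left Q0 Q1) (min_le_right Q0 Q1) (d n)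
      rw [e, abs_mul, abs_of_pos (by linarith : 0 < qb Q0 Q1 (d n)), pow_succ, ← mul_assoc,
        mul_comm (qb Q0 Q1 (d n))]
      have : 0 ≤ min Q0 Q1 := by linarith
      gcongr
  by_contra hne
  have hpos : 0 < |y 0 - piE Q0 Q1 d| := abs_pos.2 (sub_ne_zero.2 (Ne.symm hne))
  obtain ⟨n, hn⟩ := pow_unbounded_of_one_lt ((C + (Q1 - 1)⁻¹) / |y 0 - piE Q0 Q1 d|) hm
  rw [div_lt_iff₀ hpos] at hn
  have h2 := key n
  have h3 : |y n - piE Q0 Q1 (shiftTail d n)| ≤ C + (Q1 - 1)⁻¹ := by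
    refine (abs_sub _ _).trans (add_le_add (hC n) ?_)
    rw [abs_of_nonneg (piE_nonneg h0 h1 _)]
    exact piE_le h0 h1 _
  linarith

/-- The orbit of the two-branch map with threshold `A`. -/
noncomputable def orb (Q0 Q1 A x : ℝ) : ℕ → ℝ
  | 0 => x
  | n + 1 => if A < orb Q0 Q1 A x n then Q1 * orb Q0 Q1 A x n - 1 else Q0 * orb Q0 Q1 A x n

lemma shift_cat (w : List Bool) (u : ℕ → Bool) : shiftTail (cat w u) w.length = u := by
  induction w with
  | nil => simp [cat]
  | cons d w ih => rw [cat, List.length_cons, shift_cs, ih]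

lemma surj (hW : memW a b) {Q0 Q1 : ℝ} (h0 : 1 < Q0) (h1 : 1 < Q1) {u v : ℕ → Bool}
    (hu : u ∈ Omega a b) (hu0 : u 0 = false)
    (humax : ∀ x ∈ Omega a b, x 0 = false → piE Q0 Q1 x ≤ piE Q0 Q1 u)
    (hv : v ∈ Omega a b) (hv0 : v 0 = true)
    (hvmin : ∀ x ∈ Omega a b, x 0 = true → piE Q0 Q1 v ≤ piE Q0 Q1 x)
    (huv : piE Q0 Q1 v ≤ piE Q0 Q1 u) :
    Set.Icc 0 ((Q1 - 1)⁻¹) ⊆ piE Q0 Q1 '' Omega a b := by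
  classical
  intro x hx
  obtain ⟨ha, hb, haO, hbO⟩ := hW
  set A := piE Q0 Q1 u with hA
  have hK : 0 < (Q1 - 1)⁻¹ := inv_pos.2 (by linarith)
  have hKe : (Q1 - 1)⁻¹ * Q1 = (Q1 - 1)⁻¹ + 1 := by
    have : Q1 - 1 ≠ 0 := by linarith
    field_simp
    ring
  have A1 : Q0 * A ≤ (Q1 - 1)⁻¹ := by
    have := piE_eq h0 h1 u
    rw [hu0, eq_div_iff (by linarith [qb_gt_one h0 h1 false])] at this
    simp only [qb, dv, Bool.false_eq_true, if_false, zero_add] at this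
    have h2 := piE_le h0 h1 (shiftTail u 1)
    simp only [hA]
    linarith
  have B1 : 1 ≤ Q1 * piE Q0 Q1 v := by
    have := piE_eq h0 h1 v
    rw [hv0, eq_div_iff (by linarith [qb_gt_one h0 h1 true])] at this
    simp only [qb, dv, if_true] at this
    have h2 := piE_nonneg h0 h1 (shiftTail v 1)
    linarith
  have horb : ∀ n, 0 ≤ orb Q0 Q1 A x n ∧ orb Q0 Q1 A x n ≤ (Q1 - 1)⁻¹ := by
    intro n
    induction n with
    | zero => exact hx
    | succ n ih =>
      rw [orb]
      split_ifs with hc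
      · constructor <;> nlinarith
      · constructor <;> nlinarith
  let e : ℕ → Bool := fun n => decide (A < orb Q0 Q1 A x n)
  have hrec : ∀ n, orb Q0 Q1 A x (n + 1) = qb Q0 Q1 (e n) * orb Q0 Q1 A x n - dv (e n) := by
    intro n
    rw [orb]
    split_ifs with hc <;> simp [e, hc, qb, dv]
  have hpi : ∀ n, piE Q0 Q1 (shiftTail e n) = orb Q0 Q1 A x n := by
    intro n
    apply bounded_orbit h0 h1 (shiftTail e n) (fun k => orb Q0 Q1 A x (n + k)) ((Q1 - 1)⁻¹)
    · intro k; exact hrec (n + k)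
    · intro k
      rw [abs_of_nonneg (horb _).1]; exact (horb _).2
  have P : ∀ n, (e n = false → piE Q0 Q1 (shiftTail e n) ≤ A) ∧
      (e n = true → A < piE Q0 Q1 (shiftTail e n)) := by
    intro n
    rw [hpi]
    simp [e]
  have heO : e ∈ Omega a b := by
    apply Om_of_tails
    intro n
    constructor
    · intro hd
      refine le_trans ?_ (Om_le hb hu hu0)
      by_contra hc
      obtain ⟨w, u', f', e1, e2, d1, d2⟩ := exists_split (not_le.1 hc)
      have hf : f' = shiftTail e (n + w.length) := by
        rw [← shift_shift, e2, shift_cat]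
      have hd2 : e (n + w.length) = true := by rw [← d2, hf]; simp [shiftTail]
      have p1 := (P n).1 hd
      have p2 := (P _).2 hd2
      rw [← hf] at p2
      have p3 := humax u' (Om_of_cat (w := w) (by rwa [← e1])) d1
      have p4 := piE_cat_sub h0 h1 w f' u'
      rw [← e1, ← e2, eq_div_iff (Qw_pos h0 h1 w).ne'] at p4
      have p5 := Qw_pos h0 h1 w
      nlinarith
    · intro hd
      refine le_trans (Om_ge ha hv hv0) ?_
      by_contra hc
      obtain ⟨w, f', v', e1, e2, d1, d2⟩ := exists_split (not_le.1 hc)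
      have hf : f' = shiftTail e (n + w.length) := by
        rw [← shift_shift, e1, shift_cat]
      have hd2 : e (n + w.length) = false := by rw [← d1, hf]; simp [shiftTail]
      have p1 := (P n).2 hd
      have p2 := (P _).1 hd2
      rw [← hf] at p2
      have p3 := hvmin v' (Om_of_cat (w := w) (by rwa [← e2])) d2
      have p4 := piE_cat_sub h0 h1 w f' v'
      rw [← e1, ← e2, eq_div_iff (Qw_pos h0 h1 w).ne'] at p4
      have p5 := Qw_ge_one h0 h1 w
      nlinarith
  refine ⟨e, heO, ?_⟩
  have := hpi 0
  rwa [shift_zero] at this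

/-- Separation of the two branches. -/
def BrSep (a b : ℕ → Bool) (Q0 Q1 δ : ℝ) : Prop :=
  ∀ u ∈ Omega a b, ∀ v ∈ Omega a b, u 0 = false → v 0 = true → δ ≤ piE Q0 Q1 v - piE Q0 Q1 u

lemma sep_or_surj (hW : memW a b) {Q0 Q1 : ℝ} (h0 : 1 < Q0) (h1 : 1 < Q1) :
    (∃ δ, 0 < δ ∧ BrSep a b Q0 Q1 δ) ∨ Set.Icc 0 ((Q1 - 1)⁻¹) ⊆ piE Q0 Q1 '' Omega a b := by
  have hcl : ∀ d : Bool, IsClosed {x : ℕ → Bool | x 0 = d} := fun d =>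
    (isClosed_discrete {c : Bool | c = d}).preimage (continuous_apply (A := fun _ : ℕ => Bool) 0)
  have hco : ∀ d : Bool, IsCompact (Omega a b ∩ {x : ℕ → Bool | x 0 = d}) := fun d =>
    (Om_closed.inter (hcl d)).isCompact
  obtain ⟨u, ⟨hu, hu0⟩, hmax⟩ := (hco false).exists_isMaxOn ⟨a, hW.2.2.1, hW.1⟩
    (piE_continuous h0 h1).continuousOn
  obtain ⟨v, ⟨hv, hv0⟩, hmin⟩ := (hco true).exists_isMinOn ⟨b, hW.2.2.2, hW.2.1⟩
    (piE_continuous h0 h1).continuousOn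
  by_cases hc : piE Q0 Q1 v ≤ piE Q0 Q1 u
  · right
    exact surj hW h0 h1 hu hu0 (fun x hx hx0 => hmax ⟨hx, hx0⟩) hv hv0
      (fun x hx hx0 => hmin ⟨hx, hx0⟩) hc
  · left
    refine ⟨piE Q0 Q1 v - piE Q0 Q1 u, by linarith, ?_⟩
    intro x hx y hy hx0 hy0
    have h3 : piE Q0 Q1 x ≤ piE Q0 Q1 u := hmax ⟨hx, hx0⟩
    have h4 : piE Q0 Q1 v ≤ piE Q0 Q1 y := hmin ⟨hy, hy0⟩
    linarith

lemma BrSep.split {Q0 Q1 δ : ℝ} (hS : BrSep a b Q0 Q1 δ) (h0 : 1 < Q0) (h1 : 1 < Q1)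
    {u v : ℕ → Bool} (hu : u ∈ Omega a b) (hv : v ∈ Omega a b) (h : toLex u < toLex v) :
    ∃ w u' v', u = cat w u' ∧ v = cat w v' ∧ δ / Qw Q0 Q1 w ≤ piE Q0 Q1 v - piE Q0 Q1 u := by
  obtain ⟨w, u', v', e1, e2, d1, d2⟩ := exists_split h
  refine ⟨w, u', v', e1, e2, ?_⟩
  rw [e1, e2, piE_cat_sub h0 h1]
  exact div_le_div_of_nonneg_right (hS u' (Om_of_cat (w := w) (by rwa [← e1])) v'
    (Om_of_cat (w := w) (by rwa [← e2])) d1 d2) (Qw_pos h0 h1 w).le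

lemma BrSep.mono {Q0 Q1 δ : ℝ} (hS : BrSep a b Q0 Q1 δ) (hδ : 0 < δ) (h0 : 1 < Q0) (h1 : 1 < Q1)
    {u v : ℕ → Bool} (hu : u ∈ Omega a b) (hv : v ∈ Omega a b) (h : toLex u ≤ toLex v) :
    piE Q0 Q1 u ≤ piE Q0 Q1 v := by
  rcases eq_or_lt_of_le h with h | h
  · rw [toLex.injective h]
  · obtain ⟨w, _, _, _, _, h3⟩ := hS.split h0 h1 hu hv h
    have := div_pos hδ (Qw_pos h0 h1 w)
    linarith

lemma BrSep.not_Z {Q0 Q1 δ : ℝ} (hS : BrSep a b Q0 Q1 δ) (hW : memW a b) (hδ : 0 < δ) (h0 : 1 < Q0)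
    (h1 : 1 < Q1) (hZ : ∀ n, 1 ≤ Z a b Q0 Q1 n) : False := by
  obtain ⟨n, hn⟩ := Rs_unbounded h0 h1 hZ ((Q1 - 1)⁻¹ / δ)
  have hD : δ ≤ piE Q0 Q1 b - piE Q0 Q1 a := hS a hW.2.2.1 b hW.2.2.2 hW.1 hW.2.1
  have hi := nu_ident hW h0 h1 n
  have hnn : 0 ≤ ∑ w ∈ Lw a b n, nu a b Q0 Q1 w * (Qw Q0 Q1 w)⁻¹ := by
    apply Finset.sum_nonneg
    intro w hw
    apply mul_nonneg _ (inv_pos.2 (Qw_pos h0 h1 w)).le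
    obtain ⟨x, y, h⟩ := Extr_exists hW w (mem_Lw.1 hw).2
    rw [nu_eq Q0 Q1 h]
    have := hS.mono hδ h0 h1 (Om_of_cat h.1) (Om_of_cat h.2.1) (h.2.2 _ h.1).2
    linarith
  rw [div_lt_iff₀ hδ] at hn
  have hR : 0 ≤ Rs a b Q0 Q1 n := by
    have := Rs_mono (a := a) (b := b) h0 h1 (Nat.zero_le n)
    simpa [Rs] using this
  nlinarith

/-- Consequences of a partition sum below one. -/
lemma D_pos (hW : memW a b) {Q0 Q1 : ℝ} (h0 : 1 < Q0) (h1 : 1 < Q1) {n : ℕ}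
    (hn : Z a b Q0 Q1 n < 1) :
    0 < piE Q0 Q1 b - piE Q0 Q1 a ∧
    ∀ N, (piE Q0 Q1 b - piE Q0 Q1 a) * Rs a b Q0 Q1 N ≤ 2 * (Q1 - 1)⁻¹ := by
  have hK : 0 < (Q1 - 1)⁻¹ := inv_pos.2 (by linarith)
  have hR : ∀ n, 0 ≤ Rs a b Q0 Q1 n := fun n => by
    have := Rs_mono (a := a) (b := b) h0 h1 (Nat.zero_le n)
    simpa [Rs] using this
  have hD : 0 < piE Q0 Q1 b - piE Q0 Q1 a := by
    have hi := nu_ident hW h0 h1 n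
    have h2 := (abs_le.1 (nu_sum_abs (a := a) (b := b) h0 h1 n)).2
    have h3 : (Q1 - 1)⁻¹ * Z a b Q0 Q1 n < (Q1 - 1)⁻¹ := by nlinarith
    have h4 : 0 < (piE Q0 Q1 b - piE Q0 Q1 a) * Rs a b Q0 Q1 n := by linarith
    exact pos_of_mul_pos_left h4 (hR n)
  refine ⟨hD, fun N => ?_⟩
  have hn0 : n ≠ 0 := by
    rintro rfl; rw [Z_zero] at hn; exact lt_irrefl _ hn
  have hi := nu_ident hW h0 h1 (N * n)
  have h2 := (abs_le.1 (nu_sum_abs (a := a) (b := b) h0 h1 (N * n))).1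
  have h3 : Z a b Q0 Q1 (N * n) ≤ 1 :=
    (Z_mul_le h0 h1 n N).trans (pow_le_one₀ (Z_nonneg h0 h1 n) hn.le)
  have h4 : Rs a b Q0 Q1 N ≤ Rs a b Q0 Q1 (N * n) :=
    Rs_mono h0 h1 (Nat.le_mul_of_pos_right N (Nat.pos_of_ne_zero hn0))
  have h5 := mul_le_mul_of_nonneg_left h4 hD.le
  have h6 := mul_le_mul_of_nonneg_left h3 hK.le
  linarith

/-! ### Dimension bounds -/

lemma dim_upper {q0 q1 : ℝ} (h0 : 1 < q0) (h1 : 1 < q1) {t : ℝ} (ht : 0 < t) {n : ℕ}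
    (hn : Z a b (q0 ^ t) (q1 ^ t) n < 1) :
    dimH (piE q0 q1 '' Omega a b) ≤ ENNReal.ofReal t := by
  have hn0 : n ≠ 0 := by
    rintro rfl; rw [Z_zero] at hn; exact lt_irrefl _ hn
  have hQ0 := rpow_gt_one h0 ht
  have hQ1 := rpow_gt_one h1 ht
  have hm := lt_min h0 h1
  have hK : 0 < (q1 - 1)⁻¹ := inv_pos.2 (by linarith)
  have hdiam : ∀ w : List Bool, Metric.ediam (piE q0 q1 '' Set.range (cat w)) ≤
      ENNReal.ofReal ((q1 - 1)⁻¹ * (Qw q0 q1 w)⁻¹) := by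
    intro w
    apply Metric.ediam_le
    rintro _ ⟨_, ⟨u, rfl⟩, rfl⟩ _ ⟨_, ⟨v, rfl⟩, rfl⟩
    rw [edist_dist, Real.dist_eq, piE_cat_sub h0 h1, abs_div, abs_of_pos (Qw_pos h0 h1 w),
      div_eq_mul_inv]
    apply ENNReal.ofReal_le_ofReal
    exact mul_le_mul_of_nonneg_right (piE_dist h0 h1 u v) (inv_pos.2 (Qw_pos h0 h1 w)).le
  have hle : MeasureTheory.Measure.hausdorffMeasure t (piE q0 q1 '' Omega a b) ≤
      ENNReal.ofReal ((q1 - 1)⁻¹ ^ t) := by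
    have key := MeasureTheory.Measure.hausdorffMeasure_le_liminf_sum (β := ℕ)
      (ι := fun k => {w // w ∈ Lw a b (k * n)}) t (piE q0 q1 '' Omega a b) (l := atTop)
      (fun k => ENNReal.ofReal ((q1 - 1)⁻¹ * ((min q0 q1) ^ (k * n))⁻¹)) ?_
      (fun k w => piE q0 q1 '' Set.range (cat w.1)) ?_ ?_
    · refine key.trans ?_
      have hev : ∀ k : ℕ, ∑ i : {w // w ∈ Lw a b (k * n)},
          Metric.ediam (piE q0 q1 '' Set.range (cat i.1)) ^ t ≤
          ENNReal.ofReal ((q1 - 1)⁻¹ ^ t) := by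
        intro k
        rw [Finset.sum_coe_sort (Lw a b (k * n))
          (fun w => Metric.ediam (piE q0 q1 '' Set.range (cat w)) ^ t)]
        calc _ ≤ ∑ w ∈ Lw a b (k * n), ENNReal.ofReal ((q1 - 1)⁻¹ ^ t *
              (Qw (q0 ^ t) (q1 ^ t) w)⁻¹) := by
              apply Finset.sum_le_sum
              intro w _
              have hQp := Qw_pos h0 h1 w
              refine (ENNReal.rpow_le_rpow (hdiam w) ht.le).trans (le_of_eq ?_)
              rw [ENNReal.ofReal_rpow_of_nonneg (by positivity) ht.le,
                Real.mul_rpow hK.le (by positivity), Qw_rpow h0 h1, Real.inv_rpow hQp.le]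
          _ = ENNReal.ofReal ((q1 - 1)⁻¹ ^ t * Z a b (q0 ^ t) (q1 ^ t) (k * n)) := by
              rw [Z, Finset.mul_sum, ENNReal.ofReal_sum_of_nonneg]
              intro w _
              have := Qw_pos hQ0 hQ1 w
              positivity
          _ ≤ _ := by
              apply ENNReal.ofReal_le_ofReal
              have h3 : Z a b (q0 ^ t) (q1 ^ t) (k * n) ≤ 1 :=
                (Z_mul_le hQ0 hQ1 n k).trans (pow_le_one₀ (Z_nonneg hQ0 hQ1 n) hn.le)
              have : 0 ≤ (q1 - 1)⁻¹ ^ t := by positivity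
              nlinarith
      refine (Filter.liminf_le_liminf (Filter.Eventually.of_forall hev)).trans ?_
      rw [Filter.liminf_const]
    · rw [← ENNReal.ofReal_zero]
      apply ENNReal.tendsto_ofReal
      rw [← mul_zero (q1 - 1)⁻¹]
      apply Tendsto.const_mul
      apply tendsto_inv_atTop_zero.comp
      apply (tendsto_pow_atTop_atTop_of_one_lt hm).comp
      exact Filter.tendsto_id.atTop_mul_const' (Nat.pos_of_ne_zero hn0)
    · refine Filter.Eventually.of_forall fun k w => (hdiam w.1).trans ?_
      apply ENNReal.ofReal_le_ofReal
      have hg := Qw_ge hm (min_le_left _ _) (min_le_right _ _) w.1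
      rw [(mem_Lw.1 w.2).1] at hg
      have : 0 < min q0 q1 ^ (k * n) := pow_pos (by linarith) _
      gcongr
    · refine Filter.Eventually.of_forall fun k => ?_
      rintro _ ⟨u, hu, rfl⟩
      obtain ⟨w, u', e, hl⟩ := exists_pref u (k * n)
      rw [Set.mem_iUnion]
      exact ⟨⟨w, mem_Lw.2 ⟨hl, u', by rwa [← e]⟩⟩, ⟨u, ⟨u', e.symm⟩, rfl⟩⟩
  have := dimH_le_of_hausdorffMeasure_ne_top (s := piE q0 q1 '' Omega a b) (d := ⟨t, ht.le⟩)
    (ne_top_of_le_ne_top ENNReal.ofReal_ne_top hle)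
  rwa [ENNReal.ofReal, Real.toNNReal_of_nonneg ht.le]

lemma dim_of_surj {Q1 : ℝ} (h1 : 1 < Q1) {S : Set ℝ} (h : Set.Icc 0 ((Q1 - 1)⁻¹) ⊆ S) :
    dimH S = 1 := by
  have hK : 0 < (Q1 - 1)⁻¹ := inv_pos.2 (by linarith)
  have : (interior S).Nonempty := by
    refine ⟨(Q1 - 1)⁻¹ / 2, interior_mono h ?_⟩
    rw [interior_Icc]
    constructor <;> linarith
  rw [Real.dimH_of_nonempty_interior this]
  simp

lemma dim_lower {q0 q1 δ : ℝ} (h0 : 1 < q0) (h1 : 1 < q1) {s : ℝ} (hs : 0 < s) (hδ : 0 < δ)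
    (hS : BrSep a b q0 q1 δ)
    (hsurj : Set.Icc 0 ((q1 ^ s - 1)⁻¹) ⊆ piE (q0 ^ s) (q1 ^ s) '' Omega a b) :
    ENNReal.ofReal s ≤ dimH (piE q0 q1 '' Omega a b) := by
  have hQ0 := rpow_gt_one h0 hs
  have hQ1 := rpow_gt_one h1 hs
  have hK : 0 < (q1 ^ s - 1)⁻¹ := inv_pos.2 (by linarith)
  set C : ℝ := (q1 ^ s - 1)⁻¹ * (δ⁻¹) ^ s with hC
  have hC0 : 0 ≤ C := by positivity
  -- comparison of distances
  have cmp' : ∀ u ∈ Omega a b, ∀ v ∈ Omega a b, toLex u < toLex v →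
      u ≠ v ∧ piE q0 q1 u ≠ piE q0 q1 v ∧ |piE (q0 ^ s) (q1 ^ s) u - piE (q0 ^ s) (q1 ^ s) v| ≤
        C * |piE q0 q1 u - piE q0 q1 v| ^ s := by
    intro u hu v hv h
    obtain ⟨w, u', v', e1, e2, h3⟩ := hS.split h0 h1 hu hv h
    have hQ := Qw_pos h0 h1 w
    have h4 := div_pos hδ hQ
    refine ⟨fun e => by rw [e] at h; exact lt_irrefl _ h, fun e => by rw [e] at h3; linarith, ?_⟩
    have h5 : (Qw q0 q1 w)⁻¹ ≤ δ⁻¹ * |piE q0 q1 u - piE q0 q1 v| := by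
      rw [abs_sub_comm, abs_of_pos (by linarith)]
      rw [div_eq_mul_inv] at h3
      calc (Qw q0 q1 w)⁻¹ = δ⁻¹ * (δ * (Qw q0 q1 w)⁻¹) := by field_simp
        _ ≤ _ := by gcongr
    have h6 : (Qw q0 q1 w)⁻¹ ^ s ≤ (δ⁻¹) ^ s * |piE q0 q1 u - piE q0 q1 v| ^ s := by
      rw [← Real.mul_rpow (by positivity) (abs_nonneg _)]
      exact Real.rpow_le_rpow (by positivity) h5 hs.le
    conv_lhs => rw [e1, e2]
    rw [piE_cat_sub hQ0 hQ1, abs_div, abs_of_pos (Qw_pos hQ0 hQ1 w), div_eq_mul_inv,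
      Qw_rpow h0 h1, ← Real.inv_rpow hQ.le, hC, mul_assoc]
    exact mul_le_mul (piE_dist hQ0 hQ1 u' v') h6 (by positivity) hK.le
  have cmp : ∀ u ∈ Omega a b, ∀ v ∈ Omega a b,
      (piE q0 q1 u = piE q0 q1 v → u = v) ∧
      |piE (q0 ^ s) (q1 ^ s) u - piE (q0 ^ s) (q1 ^ s) v| ≤
        C * |piE q0 q1 u - piE q0 q1 v| ^ s := by
    intro u hu v hv
    rcases lt_trichotomy (toLex u) (toLex v) with h | h | h
    · obtain ⟨h2, h3, h4⟩ := cmp' u hu v hv h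
      exact ⟨fun e => absurd e h3, h4⟩
    · have : u = v := toLex.injective h
      subst this
      refine ⟨fun _ => rfl, ?_⟩
      simp only [sub_self, abs_zero]
      positivity
    · obtain ⟨h2, h3, h4⟩ := cmp' v hv u hu h
      refine ⟨fun e => absurd e.symm h3, ?_⟩
      rwa [abs_sub_comm, abs_sub_comm (piE q0 q1 u)]
  let g : ℝ → (ℕ → Bool) := Function.invFunOn (piE q0 q1) (Omega a b)
  have hg : ∀ u ∈ Omega a b, g (piE q0 q1 u) = u := by
    intro u hu
    have hex : ∃ x ∈ Omega a b, piE q0 q1 x = piE q0 q1 u := ⟨u, hu, rfl⟩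
    exact (cmp _ (Function.invFunOn_mem hex) u hu).1 (Function.invFunOn_eq hex)
  have hH : HolderOnWith C.toNNReal s.toNNReal (fun x => piE (q0 ^ s) (q1 ^ s) (g x))
      (piE q0 q1 '' Omega a b) := by
    rintro _ ⟨u, hu, rfl⟩ _ ⟨v, hv, rfl⟩
    simp only
    rw [hg u hu, hg v hv, edist_dist, edist_dist, Real.dist_eq, Real.dist_eq,
      Real.coe_toNNReal _ hs.le, ENNReal.ofReal_rpow_of_nonneg (abs_nonneg _) hs.le]
    change _ ≤ ENNReal.ofReal C * _
    rw [← ENNReal.ofReal_mul hC0]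
    exact ENNReal.ofReal_le_ofReal (cmp u hu v hv).2
  have hdim := hH.dimH_image_le (by simpa using hs)
  have h1' : dimH ((fun x => piE (q0 ^ s) (q1 ^ s) (g x)) '' (piE q0 q1 '' Omega a b)) = 1 := by
    apply dim_of_surj hQ1
    refine hsurj.trans ?_
    rintro _ ⟨u, hu, rfl⟩
    exact ⟨_, ⟨u, hu, rfl⟩, by simp only [hg u hu]⟩
  rw [h1', ENNReal.le_div_iff_mul_le, one_mul] at hdim
  · exact hdim
  · left; simpa using hs
  · left; simp

end Surj

/-! ### Dependence on the exponent -/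

section Expo
variable {a b : ℕ → Bool} {q0 q1 : ℝ}

lemma Qw_inv_cont (h0 : 1 < q0) (h1 : 1 < q1) (w : List Bool) :
    Continuous (fun s : ℝ => (Qw (q0 ^ s) (q1 ^ s) w)⁻¹) := by
  have hQ := Qw_pos h0 h1 w
  simp only [Qw_rpow h0 h1]
  exact (Real.continuous_const_rpow hQ.ne').inv₀ fun s => (Real.rpow_pos_of_pos hQ s).ne'

lemma Z_cont (h0 : 1 < q0) (h1 : 1 < q1) (n : ℕ) :
    Continuous (fun s : ℝ => Z a b (q0 ^ s) (q1 ^ s) n) := by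
  unfold Z
  exact continuous_finsetSum _ fun w _ => Qw_inv_cont h0 h1 w

lemma Rs_cont (h0 : 1 < q0) (h1 : 1 < q1) (n : ℕ) :
    Continuous (fun s : ℝ => Rs a b (q0 ^ s) (q1 ^ s) n) := by
  unfold Rs rs
  refine continuous_finsetSum _ fun k _ => continuous_finsetSum _ fun w _ => ?_
  split_ifs
  · exact Qw_inv_cont h0 h1 w
  · exact continuous_const

lemma Z_anti (h0 : 1 < q0) (h1 : 1 < q1) (n : ℕ) {s t : ℝ} (hst : s ≤ t) :
    Z a b (q0 ^ t) (q1 ^ t) n ≤ Z a b (q0 ^ s) (q1 ^ s) n := by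
  unfold Z
  refine Finset.sum_le_sum fun w _ => ?_
  rw [Qw_rpow h0 h1, Qw_rpow h0 h1]
  exact inv_anti₀ (Real.rpow_pos_of_pos (Qw_pos h0 h1 w) s)
    (Real.rpow_le_rpow_of_exponent_le (Qw_ge_one h0 h1 w) hst)

lemma Qw_mono {Q0 Q1 P : ℝ} (h0 : 1 < Q0) (h1 : 1 < Q1) (e0 : Q0 ≤ P) (e1 : Q1 ≤ P)
    (w : List Bool) : Qw Q0 Q1 w ≤ Qw P P w := by
  induction w with
  | nil => simp
  | cons d w ih =>
    rw [Qw_cons, Qw_cons]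
    have : qb Q0 Q1 d ≤ qb P P d := by cases d <;> simpa [qb]
    exact mul_le_mul this ih (Qw_pos h0 h1 w).le
      (by linarith [qb_gt_one h0 h1 d])

lemma Z_ge_one_of_eq (hW : memW a b) {Q0 Q1 : ℝ} (h0 : 1 < Q0) (h1 : 1 < Q1)
    (h : piE Q0 Q1 a = piE Q0 Q1 b) (n : ℕ) : 1 ≤ Z a b Q0 Q1 n := by
  by_contra hc
  have := (D_pos hW h0 h1 (not_le.1 hc)).1
  linarith

/-- The exponents with negative pressure. -/
def Eset (a b : ℕ → Bool) (q0 q1 : ℝ) : Set ℝ :=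
  {s | 0 < s ∧ ∃ n, Z a b (q0 ^ s) (q1 ^ s) n < 1}

lemma Eset_lower (hW : memW a b) (h0 : 1 < q0) (h1 : 1 < q1) {q : ℝ} (hq : 1 < q)
    (h : piE q q a = piE q q b) {s : ℝ} (hs : s ∈ Eset a b q0 q1) :
    Real.log q / Real.log (max q0 q1) ≤ s := by
  obtain ⟨hs0, n, hn⟩ := hs
  have hM : 1 < max q0 q1 := lt_max_of_lt_left h0
  rw [div_le_iff₀ (Real.log_pos hM)]
  by_contra hc
  rw [not_le, ← Real.log_rpow (by linarith)] at hc
  have hlt := (Real.log_lt_log_iff (Real.rpow_pos_of_pos (by linarith) _) (by linarith)).1 hc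
  have e0 : q0 ^ s ≤ q :=
    (Real.rpow_le_rpow (by linarith) (le_max_left q0 q1) hs0.le).trans hlt.le
  have e1 : q1 ^ s ≤ q :=
    (Real.rpow_le_rpow (by linarith) (le_max_right q0 q1) hs0.le).trans hlt.le
  have hQ0 := rpow_gt_one h0 hs0
  have hQ1 := rpow_gt_one h1 hs0
  have h2 := Z_ge_one_of_eq hW hq hq h n
  have h3 : Z a b q q n ≤ Z a b (q0 ^ s) (q1 ^ s) n := by
    unfold Z
    exact Finset.sum_le_sum fun w _ =>
      inv_anti₀ (Qw_pos hQ0 hQ1 w) (Qw_mono hQ0 hQ1 e0 e1 w)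
  linarith

lemma Eset_nonempty (h0 : 1 < q0) (h1 : 1 < q1) : (Eset a b q0 q1).Nonempty := by
  have hm := lt_min h0 h1
  obtain ⟨k, hk⟩ := pow_unbounded_of_one_lt 2 hm
  have hk0 : k ≠ 0 := by rintro rfl; norm_num at hk
  have hk1 : (0 : ℝ) < k := by exact_mod_cast Nat.pos_of_ne_zero hk0
  refine ⟨k, hk1, 1, ?_⟩
  have e0 : 2 < q0 ^ (k : ℝ) := by
    rw [Real.rpow_natCast]
    exact hk.trans_le (pow_le_pow_left₀ (by linarith) (min_le_left _ _) k)
  have e1 : 2 < q1 ^ (k : ℝ) := by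
    rw [Real.rpow_natCast]
    exact hk.trans_le (pow_le_pow_left₀ (by linarith) (min_le_right _ _) k)
  have i0 : (q0 ^ (k : ℝ))⁻¹ < 2⁻¹ := inv_strictAnti₀ (by norm_num) e0
  have i1 : (q1 ^ (k : ℝ))⁻¹ < 2⁻¹ := inv_strictAnti₀ (by norm_num) e1
  have p0 : 0 < (q0 ^ (k : ℝ))⁻¹ := inv_pos.2 (by linarith)
  have p1 : 0 < (q1 ^ (k : ℝ))⁻¹ := inv_pos.2 (by linarith)
  rw [Z, sum_Lw_succ]
  simp only [Lw, Finset.sum_singleton, List.nil_append, Qw_cons, Qw_nil, mul_one, qb,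
    Bool.false_eq_true, if_false, if_true]
  split_ifs <;> linarith

end Expo

/-- Theorem: if `(a,b) ∈ W`, `q₀,q₁ > 1` and `π_{q,q}(a) = π_{q,q}(b)` for some `q > 1`, then
there is a maximal `s > 0` with `π_{q₀^s,q₁^s}(a) = π_{q₀^s,q₁^s}(b)`, and
`dim_H π_{q₀,q₁}(Ω_{a,b}) = min {1, s}`. -/
theorem stmt2 (a b : ℕ → Bool) (q0 q1 : ℝ) (hW : memW a b) (hq0 : 1 < q0) (hq1 : 1 < q1)
    (h : ∃ q : ℝ, 1 < q ∧ piE q q a = piE q q b) :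
    ∃ s : ℝ, 0 < s ∧ piE (q0 ^ s) (q1 ^ s) a = piE (q0 ^ s) (q1 ^ s) b ∧
      (∀ t : ℝ, s < t → piE (q0 ^ t) (q1 ^ t) a ≠ piE (q0 ^ t) (q1 ^ t) b) ∧
      dimH (piE q0 q1 '' Omega a b) = ENNReal.ofReal (min 1 s) := by
  obtain ⟨q, hq, hqe⟩ := h
  set E := Eset a b q0 q1 with hE
  have hlow : ∀ s ∈ E, Real.log q / Real.log (max q0 q1) ≤ s :=
    fun s hs => Eset_lower hW hq0 hq1 hq hqe hs
  have hne : E.Nonempty := Eset_nonempty hq0 hq1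
  have hbdd : BddBelow E := ⟨_, hlow⟩
  set s := sInf E with hsdef
  have hs : 0 < s :=
    (div_pos (Real.log_pos hq) (Real.log_pos (lt_max_of_lt_left hq0))).trans_le (le_csInf hne hlow)
  have hQ0 := rpow_gt_one hq0 hs
  have hQ1 := rpow_gt_one hq1 hs
  -- above `s` the pressure is negative
  have habove : ∀ t, s < t → ∃ n, Z a b (q0 ^ t) (q1 ^ t) n < 1 := by
    intro t ht
    obtain ⟨e, he, het⟩ := exists_lt_of_csInf_lt hne ht
    obtain ⟨_, n, hn⟩ := he
    exact ⟨n, (Z_anti hq0 hq1 n het.le).trans_lt hn⟩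
  -- at `s` all partition sums are at least one
  have hat : ∀ n, 1 ≤ Z a b (q0 ^ s) (q1 ^ s) n := by
    intro n
    by_contra hc
    have hev : ∀ᶠ t in 𝓝 s, Z a b (q0 ^ t) (q1 ^ t) n < 1 :=
      (Z_cont hq0 hq1 n).continuousAt.eventually_lt continuousAt_const (not_le.1 hc)
    have hev2 : ∀ᶠ t in 𝓝[<] s, t ∈ E := by
      filter_upwards [nhdsWithin_le_nhds hev, nhdsWithin_le_nhds (lt_mem_nhds hs)] with t h1 h2
      exact ⟨h2, n, h1⟩
    obtain ⟨t, ht, hts⟩ := (hev2.and self_mem_nhdsWithin).exists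
    exact absurd (csInf_le hbdd ht) (not_le.2 hts)
  have hDcont : ContinuousAt
      (fun t : ℝ => piE (q0 ^ t) (q1 ^ t) b - piE (q0 ^ t) (q1 ^ t) a) s :=
    (piE_continuousAt hq0 hq1 b hs).sub (piE_continuousAt hq0 hq1 a hs)
  have hDabove : ∀ t, s < t → 0 < piE (q0 ^ t) (q1 ^ t) b - piE (q0 ^ t) (q1 ^ t) a ∧
      ∀ N, (piE (q0 ^ t) (q1 ^ t) b - piE (q0 ^ t) (q1 ^ t) a) * Rs a b (q0 ^ t) (q1 ^ t) N
        ≤ 2 * (q1 ^ t - 1)⁻¹ := by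
    intro t ht
    obtain ⟨n, hn⟩ := habove t ht
    exact D_pos hW (rpow_gt_one hq0 (hs.trans ht)) (rpow_gt_one hq1 (hs.trans ht)) hn
  have hD : piE (q0 ^ s) (q1 ^ s) b - piE (q0 ^ s) (q1 ^ s) a = 0 := by
    rcases lt_trichotomy (piE (q0 ^ s) (q1 ^ s) b - piE (q0 ^ s) (q1 ^ s) a) 0 with hc | hc | hc
    · have hev := hDcont.eventually_lt continuousAt_const hc
      have hev2 : ∀ᶠ t in 𝓝[>] s,
          piE (q0 ^ t) (q1 ^ t) b - piE (q0 ^ t) (q1 ^ t) a < 0 := nhdsWithin_le_nhds hev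
      obtain ⟨t, ht, hts⟩ := (hev2.and self_mem_nhdsWithin).exists
      linarith [(hDabove t hts).1]
    · exact hc
    · exfalso
      set d := (piE (q0 ^ s) (q1 ^ s) b - piE (q0 ^ s) (q1 ^ s) a) / 2 with hd
      have hd0 : 0 < d := by linarith
      have hev : ∀ᶠ t in 𝓝 s, d < piE (q0 ^ t) (q1 ^ t) b - piE (q0 ^ t) (q1 ^ t) a :=
        continuousAt_const.eventually_lt hDcont (by linarith)
      have hev2 : ∀ᶠ t in 𝓝[>] s,
          d < piE (q0 ^ t) (q1 ^ t) b - piE (q0 ^ t) (q1 ^ t) a := nhdsWithin_le_nhds hev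
      obtain ⟨N, hN⟩ := Rs_unbounded hQ0 hQ1 hat (2 * (q1 ^ s - 1)⁻¹ / d)
      have hlim : Tendsto (fun t : ℝ => Rs a b (q0 ^ t) (q1 ^ t) N) (𝓝[>] s)
          (𝓝 (Rs a b (q0 ^ s) (q1 ^ s) N)) :=
        ((Rs_cont hq0 hq1 N).tendsto s).mono_left nhdsWithin_le_nhds
      refine absurd (le_of_tendsto hlim ?_) (not_le.2 hN)
      filter_upwards [hev2, self_mem_nhdsWithin] with t h1 h2
      have h2' : s < t := h2
      have h3 := (hDabove t h2').2 N
      have hT0 := rpow_gt_one hq0 (hs.trans h2')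
      have hT1 := rpow_gt_one hq1 (hs.trans h2')
      have hR : 0 ≤ Rs a b (q0 ^ t) (q1 ^ t) N := by
        have := Rs_mono (a := a) (b := b) hT0 hT1 (Nat.zero_le N)
        simpa [Rs] using this
      have hKK : (q1 ^ t - 1)⁻¹ ≤ (q1 ^ s - 1)⁻¹ :=
        inv_anti₀ (by linarith)
          (by linarith [Real.rpow_le_rpow_of_exponent_le hq1.le h2'.le])
      rw [le_div_iff₀ hd0]
      nlinarith [mul_le_mul_of_nonneg_right h1.le hR]
  refine ⟨s, hs, by linarith, fun t ht he => ?_, ?_⟩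
  · linarith [(hDabove t ht).1]
  have hup : dimH (piE q0 q1 '' Omega a b) ≤ ENNReal.ofReal s := by
    have hlim : Tendsto (fun t : ℝ => ENNReal.ofReal t) (𝓝[>] s) (𝓝 (ENNReal.ofReal s)) :=
      (ENNReal.continuous_ofReal.tendsto s).mono_left nhdsWithin_le_nhds
    refine ge_of_tendsto hlim ?_
    filter_upwards [self_mem_nhdsWithin] with t ht
    obtain ⟨n, hn⟩ := habove t ht
    exact dim_upper hq0 hq1 (hs.trans ht) hn
  have hsurj : Set.Icc 0 ((q1 ^ s - 1)⁻¹) ⊆ piE (q0 ^ s) (q1 ^ s) '' Omega a b := by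
    rcases sep_or_surj hW hQ0 hQ1 with ⟨δ, hδ, hS⟩ | h
    · exact (hS.not_Z hW hδ hQ0 hQ1 hat).elim
    · exact h
  rcases sep_or_surj hW hq0 hq1 with ⟨δ, hδ, hS⟩ | h
  · have hs1 : s ≤ 1 := by
      by_contra hc
      refine hS.not_Z hW hδ hq0 hq1 fun n => ?_
      have h2 := Z_anti (a := a) (b := b) hq0 hq1 n (not_le.1 hc).le
      rw [Real.rpow_one, Real.rpow_one] at h2
      exact (hat n).trans h2
    rw [min_eq_right hs1]
    exact le_antisymm hup (dim_lower hq0 hq1 hs hδ hS hsurj)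
  · have h1 := dim_of_surj hq1 h
    rw [h1] at hup ⊢
    have hs1 : 1 ≤ s := by
      rwa [← ENNReal.ofReal_one, ENNReal.ofReal_le_ofReal_iff hs.le] at hup
    rw [min_eq_left hs1, ENNReal.ofReal_one]
end
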